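/- arXiv:1412.1537 — 2 statements merged into one kernel-verified Lean document; each statement's English description precedes it below -/
import Mathlib

section
/- Let n ≥ 2, δ > 0, μ > 0, and 1 ≤ p < 1 + 4/(n−1). Suppose V ∈ C¹(D) ∩ L^∞(D) satisfies V > 0 on D and t·∂_t V + r·∂_r V > [−((n−1)/2)·(1 + 4/(n−1) − p) + μ]·V everywhere on D. Suppose φ ∈ C²(D) satisfies the focusing equation □φ + V·|φ|^{p−1}φ = 0 on D, satisfies the decay condition Dec(δ), and satisfies sup_{D∩{|uv|>1}} [(1+|u|)(1+|v|)]^{(n−1+δ)/(p+1)} |uv|^{1/(p+1)} V^{1/(p+1)} |φ| < ∞. Then φ = 0 everywhere on D. -/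
open Real MeasureTheory
open scoped BigOperators

noncomputable section

/-- Minkowski spacetime `ℝ^{1+n}`, with coordinates `(t, x)`. -/
abbrev Spacetime (n : ℕ) := ℝ × EuclideanSpace ℝ (Fin n)

/-- The exterior `D` of the light cone: `{(t,x) : |t| < |x|}`. -/
def Dom (n : ℕ) : Set (Spacetime n) := {p | |p.1| < ‖p.2‖}

/-- Partial derivative in the time direction. -/
def dt {n : ℕ} (φ : Spacetime n → ℝ) (p : Spacetime n) : ℝ :=
  fderiv ℝ φ p (1, 0)

/-- Partial derivative in the `i`-th spatial direction. -/
def dx {n : ℕ} (i : Fin n) (φ : Spacetime n → ℝ) (p : Spacetime n) : ℝ :=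
  fderiv ℝ φ p (0, EuclideanSpace.single i 1)

/-- The wave operator `□φ = −∂²_t φ + Δ_x φ`. -/
def box {n : ℕ} (φ : Spacetime n → ℝ) (p : Spacetime n) : ℝ :=
  - dt (dt φ) p + ∑ i, dx i (dx i φ) p

/-- Null coordinate `u = (t − r)/2`. -/
def uu {n : ℕ} (p : Spacetime n) : ℝ := (p.1 - ‖p.2‖) / 2

/-- Null coordinate `v = (t + r)/2`. -/
def vv {n : ℕ} (p : Spacetime n) : ℝ := (p.1 + ‖p.2‖) / 2

/-- Radial derivative `∂_r φ = (x/|x|)·∇_x φ`. -/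
def dr {n : ℕ} (φ : Spacetime n → ℝ) (p : Spacetime n) : ℝ :=
  (∑ i, p.2 i * dx i φ p) / ‖p.2‖

/-- `∂_u φ := ∂_t φ − ∂_r φ`. -/
def du {n : ℕ} (φ : Spacetime n → ℝ) (p : Spacetime n) : ℝ := dt φ p - dr φ p

/-- `∂_v φ := ∂_t φ + ∂_r φ`. -/
def dv {n : ℕ} (φ : Spacetime n → ℝ) (p : Spacetime n) : ℝ := dt φ p + dr φ p

/-- The squared angular gradient `|∇̸φ|² = |∇_x φ|² − (∂_r φ)²`. -/
def angSq {n : ℕ} (φ : Spacetime n → ℝ) (p : Spacetime n) : ℝ :=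
  (∑ i, (dx i φ p) ^ 2) - (dr φ p) ^ 2

/-- The decay condition `Dec(γ)` on `D`. -/
def Dec {n : ℕ} (γ : ℝ) (φ : Spacetime n → ℝ) : Prop :=
  (∃ C : ℝ, ∀ p ∈ Dom n,
    ((1 + |uu p|) * (1 + |vv p|)) ^ (((n : ℝ) - 1 + γ) / 2) *
      (|uu p * du φ p| + |vv p * dv φ p|) ≤ C) ∧
  (∃ C : ℝ, ∀ p ∈ Dom n, |uu p * vv p| < 1 →
    ((1 + |uu p|) * (1 + |vv p|)) ^ (((n : ℝ) - 1 + γ) / 2) *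
      |uu p * vv p| ^ ((1 : ℝ) / 2) * Real.sqrt (angSq φ p) ≤ C) ∧
  (∃ C : ℝ, ∀ p ∈ Dom n,
    ((1 + |uu p|) * (1 + |vv p|)) ^ (((n : ℝ) - 1 + γ) / 2) * |φ p| ≤ C)


lemma int_fderiv_zero {n : ℕ} (F : Spacetime n → ℝ) (D K : Set (Spacetime n)) (hD : IsOpen D)
    (hK : IsCompact K) (hKD : K ⊆ D) (hF : ContDiffOn ℝ 1 F D) (h0 : ∀ q, q ∉ K → F q = 0)
    (v : Spacetime n) :
    Integrable (fun q => fderiv ℝ F q v) ∧ ∫ q, fderiv ℝ F q v = 0 := by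
  have hsub : Function.support F ⊆ K := by
    intro q hq
    by_contra h
    exact hq (h0 q h)
  have hcs : HasCompactSupport F := HasCompactSupport.of_support_subset_isCompact hK hsub
  have hcd : ContDiff ℝ 1 F := by
    rw [contDiff_iff_contDiffAt]
    intro x
    by_cases hx : x ∈ D
    · exact hF.contDiffAt (hD.mem_nhds hx)
    · have hxK : x ∈ Kᶜ := fun h => hx (hKD h)
      have he : F =ᶠ[nhds x] fun _ => (0:ℝ) := by
        filter_upwards [hK.isClosed.isOpen_compl.mem_nhds hxK] with y hy
        exact h0 y hy
      exact contDiffAt_const.congr_of_eventuallyEq he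
  have hc : Continuous (fun q => fderiv ℝ F q v) :=
    (hcd.continuous_fderiv (by norm_num)).clm_apply continuous_const
  have hi : Integrable (fun q => fderiv ℝ F q v) :=
    hc.integrable_of_hasCompactSupport (hcs.fderiv_apply ℝ v)
  refine ⟨hi, ?_⟩
  have : (volume : Measure (Spacetime n)).IsAddHaarMeasure :=
    inferInstanceAs ((volume : Measure ℝ).prod
      (volume : Measure (EuclideanSpace ℝ (Fin n)))).IsAddHaarMeasure
  have := integral_mul_fderiv_eq_neg_fderiv_mul_of_integrable (μ := (volume : Measure (Spacetime n)))
    (f := fun _ => (1:ℝ)) (g := F) (v := v) (by simp) (by simpa using hi)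
    (by simpa using hcd.continuous.integrable_of_hasCompactSupport hcs)
    (by intro x _; fun_prop) (by intro x _; exact (hcd.differentiable (by norm_num)) x)
  simpa using this

/-- one-dimensional profile -/
def gG (b δ s : ℝ) : ℝ := Set.indicator (Set.Ioi 0) (fun s => s ^ (b - 1) * (1 + s) ^ (-δ)) s

lemma gG_nonneg (b δ s : ℝ) : 0 ≤ gG b δ s := by
  unfold gG
  apply Set.indicator_nonneg
  intro s hs
  have : (0:ℝ) < s := hs
  positivity

lemma gG_meas (b δ : ℝ) : Measurable (gG b δ) := by
  unfold gG
  apply Measurable.indicator _ measurableSet_Ioi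
  fun_prop

lemma gG_int (b δ : ℝ) (hb : 0 < b) (hbδ : b < δ) : Integrable (gG b δ) := by
  have h1 : IntegrableOn (fun s : ℝ => s ^ (b - 1)) (Set.Ioc 0 1) := by
    have := intervalIntegral.intervalIntegrable_rpow' (a := 0) (b := 1) (r := b - 1) (by linarith)
    rwa [intervalIntegrable_iff_integrableOn_Ioc_of_le (by norm_num)] at this
  have h2 : IntegrableOn (fun s : ℝ => s ^ (b - 1 - δ)) (Set.Ioi 1) :=
    integrableOn_Ioi_rpow_of_lt (by linarith) (by norm_num)
  have hm : Measurable (fun s : ℝ => s ^ (b - 1) * (1 + s) ^ (-δ)) := by fun_prop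
  have h3 : IntegrableOn (fun s : ℝ => s ^ (b - 1) * (1 + s) ^ (-δ)) (Set.Ioc 0 1) := by
    apply Integrable.mono' h1 hm.aestronglyMeasurable
    filter_upwards [ae_restrict_mem measurableSet_Ioc] with s hs
    have hs0 : 0 < s := hs.1
    rw [Real.norm_of_nonneg (by positivity)]
    have : (1 + s) ^ (-δ) ≤ 1 := Real.rpow_le_one_of_one_le_of_nonpos (by linarith) (by linarith)
    nlinarith [Real.rpow_pos_of_pos hs0 (b - 1)]
  have h4 : IntegrableOn (fun s : ℝ => s ^ (b - 1) * (1 + s) ^ (-δ)) (Set.Ioi 1) := by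
    apply Integrable.mono' h2 hm.aestronglyMeasurable
    filter_upwards [ae_restrict_mem measurableSet_Ioi] with s hs
    have hs1 : 1 < s := hs
    have hs0 : 0 < s := by linarith
    rw [Real.norm_of_nonneg (by positivity), sub_eq_add_neg (b - 1), Real.rpow_add hs0]
    have : (1 + s) ^ (-δ) ≤ s ^ (-δ) :=
      Real.rpow_le_rpow_of_nonpos hs0 (by linarith) (by linarith)
    gcongr
  have h5 := h3.union h4
  rw [Set.Ioc_union_Ioi_eq_Ioi (by norm_num)] at h5
  exact (integrable_indicator_iff measurableSet_Ioi).2 h5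

def KK (n : ℕ) (b δ : ℝ) (q : Spacetime n) : ℝ :=
  gG b δ |q.1| * (gG b δ (‖q.2‖ - |q.1|) * (‖q.2‖ ^ (n - 1))⁻¹)

lemma KK_int (n : ℕ) (hn : 2 ≤ n) (b δ : ℝ) (hb : 0 < b) (hbδ : b < δ) :
    Integrable (KK n b δ) := by
  have hgm := gG_meas b δ
  have hgi := gG_int b δ hb hbδ
  have : Nontrivial (EuclideanSpace ℝ (Fin n)) := by
    have : Nonempty (Fin n) := ⟨⟨0, by omega⟩⟩
    infer_instance
  have hdim : Module.finrank ℝ (EuclideanSpace ℝ (Fin n)) = n := by simp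
  have hm : Measurable (KK n b δ) := by
    unfold KK
    fun_prop
  have key : ∀ t : ℝ, ∀ y ∈ Set.Ioi (0:ℝ), y ^ (n - 1) • (gG b δ |t| * (gG b δ (y - |t|) * (y ^ (n - 1))⁻¹))
      = gG b δ |t| * gG b δ (y - |t|) := by
    intro t y hy
    have : (0:ℝ) < y := hy
    simp only [smul_eq_mul]
    field_simp
  have hIntg : ∀ t : ℝ, Integrable (fun y => gG b δ |t| * gG b δ (y - |t|)) := by
    intro t
    exact (hgi.comp_sub_right _).const_mul _
  have hv : ∀ t : ℝ, ∫ y in Set.Ioi (0:ℝ), gG b δ |t| * gG b δ (y - |t|)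
      = gG b δ |t| * ∫ y, gG b δ y := by
    intro t
    rw [setIntegral_eq_integral_of_forall_compl_eq_zero, integral_const_mul,
      integral_sub_right_eq_self (fun y => gG b δ y)]
    intro y hy
    have : ¬ (0 < y - |t|) := by
      have := abs_nonneg t
      simp at hy
      linarith
    simp [gG, this]
  have hvol : (volume : Measure (Spacetime n)) = (volume : Measure ℝ).prod volume := rfl
  rw [hvol, integrable_prod_iff hm.aestronglyMeasurable]
  constructor
  · refine Filter.Eventually.of_forall fun t => ?_
    have := integrable_fun_norm_addHaar (volume : Measure (EuclideanSpace ℝ (Fin n)))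
      (f := fun y => gG b δ |t| * (gG b δ (y - |t|) * (y ^ (n - 1))⁻¹))
    rw [hdim] at this
    refine this.2 ?_
    rw [integrableOn_congr_fun (key t) measurableSet_Ioi]
    exact (hIntg t).integrableOn
  · have e : (fun t => ∫ x, ‖KK n b δ (t, x)‖) = fun t => (n * ((volume : Measure (EuclideanSpace ℝ (Fin n))).real (Metric.ball 0 1))) * (∫ y, gG b δ y) * gG b δ |t| := by
      ext t
      have h1 : ∀ x, ‖KK n b δ (t, x)‖ = gG b δ |t| * (gG b δ (‖x‖ - |t|) * (‖x‖ ^ (n - 1))⁻¹) := by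
        intro x
        have := gG_nonneg b δ |t|
        have := gG_nonneg b δ (‖x‖ - |t|)
        rw [Real.norm_of_nonneg]
        · rfl
        · unfold KK; positivity
      simp only [h1]
      rw [integral_fun_norm_addHaar (volume : Measure (EuclideanSpace ℝ (Fin n))) (fun y => gG b δ |t| * (gG b δ (y - |t|) * (y ^ (n - 1))⁻¹)), hdim,
        setIntegral_congr_fun measurableSet_Ioi (key t), hv]
      simp
      ring
    rw [e]
    apply Integrable.const_mul
    have := integrable_fun_norm_addHaar (volume : Measure ℝ) (f := gG b δ)
    simp only [Real.norm_eq_abs, Module.finrank_self] at this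
    exact this.2 (by simpa using hgi.integrableOn)

def HH (n : ℕ) (b δ : ℝ) : Spacetime n → ℝ := Set.indicator (Dom n) fun q =>
  (-(uu q * vv q)) ^ (b - 1) * ((1 + |uu q|) * (1 + |vv q|)) ^ (-((n : ℝ) - 1 + δ))

lemma Dom_open (n : ℕ) : IsOpen (Dom n) := by
  unfold Dom
  exact isOpen_lt (by fun_prop) (by fun_prop)

lemma HH_int (n : ℕ) (hn : 2 ≤ n) (b δ : ℝ) (hb : 0 < b) (hb1 : b ≤ 1) (hbδ : b < δ) :
    Integrable (HH n b δ) := by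
  have hm : Measurable (HH n b δ) := by
    unfold HH
    apply Measurable.indicator _ (Dom_open n).measurableSet
    unfold uu vv
    fun_prop
  have hK := KK_int n hn b δ hb hbδ
  apply Integrable.mono' (hK.const_mul ((1/4:ℝ) ^ (b-1) * (1/4:ℝ) ^ (-δ))) hm.aestronglyMeasurable
  have hae : ∀ᵐ q : Spacetime n, q.1 ≠ 0 := by
    have h0 : ∀ᵐ t : ℝ, t ≠ 0 := by
      simp [ae_iff]
    exact Measure.quasiMeasurePreserving_fst.ae h0
  filter_upwards [hae] with q hq
  have hg1 := gG_nonneg b δ |q.1|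
  have hg2 := gG_nonneg b δ (‖q.2‖ - |q.1|)
  by_cases hD : q ∈ Dom n
  · have hD' : |q.1| < ‖q.2‖ := hD
    have ht : 0 < |q.1| := abs_pos.2 hq
    have hs : 0 < ‖q.2‖ - |q.1| := by linarith
    have hr : 0 < ‖q.2‖ := by linarith
    simp only [HH, Set.indicator_of_mem hD, KK, gG, Set.indicator_of_mem (show |q.1| ∈ Set.Ioi 0 from ht),
      Set.indicator_of_mem (show ‖q.2‖ - |q.1| ∈ Set.Ioi 0 from hs)]
    set t := |q.1|
    set r := ‖q.2‖
    have hsq : q.1 ^ 2 = t ^ 2 := (sq_abs _).symm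
    have hf : -(uu q * vv q) = (r - t) * (r + t) / 4 := by
      unfold uu vv
      have : q.1 ^ 2 = t ^ 2 := hsq
      linear_combination (-1/4 : ℝ) * this
    have hu : |uu q| = (r - q.1) / 2 := by
      unfold uu; rw [abs_of_neg]
      · ring
      · have := le_abs_self q.1; change q.1 ≤ t at this; change (q.1 - r) / 2 < 0; linarith
    have hvv : |vv q| = (r + q.1) / 2 := by
      unfold vv; rw [abs_of_pos]
      · ring
      · have := neg_abs_le q.1; change -t ≤ q.1 at this; change 0 < (q.1 + r) / 2; linarith
    have hW : (1 + |uu q|) * (1 + |vv q|) = 1 + r + (r-t) * (r+t)/4 := by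
      rw [hu, hvv]; linear_combination (-1/4 : ℝ) * hsq
    have hW1 : r ≤ (1 + |uu q|) * (1 + |vv q|) := by
      rw [hW]; have := mul_pos hs (show 0 < r + t by linarith); linarith
    have hW2 : 1/4 * ((1 + t) * (1 + (r - t))) ≤ (1 + |uu q|) * (1 + |vv q|) := by
      rw [hW]
      have := mul_pos hs ht
      have := mul_pos hs hr
      nlinarith
    have hWp : 0 < (1 + |uu q|) * (1 + |vv q|) := by positivity
    generalize (1 + |uu q|) * (1 + |vv q|) = W at hW hW1 hW2 hWp ⊢
    have hnn : 0 ≤ (-(uu q * vv q)) ^ (b - 1) * W ^ (-((n : ℝ) - 1 + δ)) := by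
      rw [hf]; positivity
    rw [Real.norm_of_nonneg hnn, hf]
    have e1 : ((r - t) * (r + t) / 4) ^ (b - 1) ≤ (1/4 * (t * (r - t))) ^ (b-1) := by
      apply Real.rpow_le_rpow_of_nonpos (by positivity) _ (by linarith)
      nlinarith [mul_pos hs hr]
    have e2 : W ^ (-((n : ℝ) - 1 + δ)) = W ^ (-δ) * (W ^ (n-1))⁻¹ := by
      rw [neg_add, add_comm, Real.rpow_add hWp, Real.rpow_neg hWp.le ((n:ℝ)-1), ← Real.rpow_natCast, Nat.cast_sub (by omega)]
      simp
    have e3 : W ^ (-δ) ≤ (1/4 * ((1 + t) * (1 + (r - t)))) ^ (-δ) :=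
      Real.rpow_le_rpow_of_nonpos (by positivity) hW2 (by linarith)
    have e4 : (W ^ (n-1))⁻¹ ≤ (r ^ (n-1))⁻¹ := by gcongr
    rw [e2]
    rw [Real.mul_rpow (by norm_num) (by positivity), Real.mul_rpow (by positivity) (by positivity)] at e1
    rw [Real.mul_rpow (by norm_num) (by positivity), Real.mul_rpow (by positivity) (by positivity)] at e3
    calc ((r - t) * (r + t) / 4) ^ (b - 1) * (W ^ (-δ) * (W ^ (n-1))⁻¹)
        ≤ ((1 / 4) ^ (b - 1) * (t ^ (b - 1) * (r - t) ^ (b - 1))) * (((1 / 4) ^ (-δ) * ((1 + t) ^ (-δ) * (1 + (r - t)) ^ (-δ))) * (r ^ (n-1))⁻¹) := by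
          gcongr
      _ = _ := by ring
  · simp only [HH, Set.indicator_of_notMem hD, norm_zero]
    unfold KK
    positivity

/-- `(r² - t²)/4` -/
def ff {n : ℕ} (q : Spacetime n) : ℝ := (‖q.2‖ ^ 2 - q.1 ^ 2) / 4

def MM {n : ℕ} (c : ℝ) (φ : Spacetime n → ℝ) (q : Spacetime n) : ℝ := fderiv ℝ φ q q + c * φ q

def QQ {n : ℕ} (φ : Spacetime n → ℝ) (q : Spacetime n) : ℝ := -(dt φ q) ^ 2 + ∑ i, (dx i φ q) ^ 2

def EE {n : ℕ} (a c p : ℝ) (V φ : Spacetime n → ℝ) (q : Spacetime n) : ℝ :=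
  -(1 / 2) * QQ φ q + a * c / 2 * (φ q ^ 2 / ff q) + V q * |φ q| ^ (p + 1) / (p + 1)

lemma vec_decomp {n : ℕ} (q : Spacetime n) (A : Spacetime n →L[ℝ] ℝ) :
    A q = q.1 * A (1, 0) + ∑ i, q.2 i * A (0, EuclideanSpace.single i 1) := by
  have hq : q = q.1 • ((1, 0) : Spacetime n) + ∑ i, q.2 i • ((0, EuclideanSpace.single i 1) : Spacetime n) := by
    ext j
    · simp [Prod.fst_sum]
    · simp [Prod.snd_sum, Finset.sum_apply, Pi.single_apply]
  conv_lhs => rw [hq]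
  simp only [map_add, map_sum, map_smul, smul_eq_mul]

lemma ff_pos {n : ℕ} {q : Spacetime n} (hq : q ∈ Dom n) : 0 < ff q := by
  have h : |q.1| < ‖q.2‖ := hq
  have := sq_lt_sq' (a := |q.1|) (b := ‖q.2‖) (by linarith [abs_nonneg q.1]) h
  rw [sq_abs] at this
  unfold ff; linarith

lemma ff_eq {n : ℕ} (q : Spacetime n) : ff q = -(uu q * vv q) := by
  unfold ff uu vv; ring

lemma div_abstract {n : ℕ} (q : Spacetime n) (w M E T : Spacetime n → ℝ) (X : Fin n → Spacetime n → ℝ)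
    (w' M' E' T' : Spacetime n →L[ℝ] ℝ) (X' : Fin n → Spacetime n →L[ℝ] ℝ)
    (hw : HasFDerivAt w w' q) (hM : HasFDerivAt M M' q) (hE : HasFDerivAt E E' q)
    (hT : HasFDerivAt T T' q) (hX : ∀ i, HasFDerivAt (X i) (X' i) q) :
    fderiv ℝ (fun q => w q * (-(T q) * M q + q.1 * E q)) q (1, 0) +
      ∑ i, fderiv ℝ (fun q => w q * (X i q * M q + q.2 i * E q)) q (0, EuclideanSpace.single i 1)
    = w' (1, 0) * (-(T q) * M q + q.1 * E q)
      + ∑ i, w' (0, EuclideanSpace.single i 1) * (X i q * M q + q.2 i * E q)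
      + w q * ((-(T' (1, 0)) + ∑ i, X' i (0, EuclideanSpace.single i 1)) * M q
        + (-(T q * M' (1, 0)) + ∑ i, X i q * M' (0, EuclideanSpace.single i 1))
        + (n + 1) * E q + E' q) := by
  have h1 : HasFDerivAt (fun q : Spacetime n => q.1) (ContinuousLinearMap.fst ℝ ℝ _) q :=
    hasFDerivAt_fst
  have h2 : ∀ i, HasFDerivAt (fun q : Spacetime n => q.2 i)
      ((EuclideanSpace.proj i : EuclideanSpace ℝ (Fin n) →L[ℝ] ℝ).comp (ContinuousLinearMap.snd ℝ ℝ _)) q := by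
    intro i
    exact ((EuclideanSpace.proj i : EuclideanSpace ℝ (Fin n) →L[ℝ] ℝ).hasFDerivAt).comp q hasFDerivAt_snd
  have h0 : HasFDerivAt (fun q => w q * (-(T q) * M q + q.1 * E q)) _ q :=
    hw.mul ((hT.neg.mul hM).add (h1.mul hE))
  rw [h0.fderiv]
  have : ∀ i, fderiv ℝ (fun q => w q * (X i q * M q + q.2 i * E q)) q (0, EuclideanSpace.single i 1)
      = w' (0, EuclideanSpace.single i 1) * (X i q * M q + q.2 i * E q)
      + w q * (X' i (0, EuclideanSpace.single i 1) * M q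
         + X i q * M' (0, EuclideanSpace.single i 1) + E q + q.2 i * E' (0, EuclideanSpace.single i 1)) := by
    intro i
    have h3 : HasFDerivAt (fun q => w q * (X i q * M q + q.2 i * E q)) _ q :=
      hw.mul (((hX i).mul hM).add ((h2 i).mul hE))
    rw [h3.fderiv]
    simp
    ring
  simp only [this]
  rw [vec_decomp q E']
  simp only [Finset.sum_add_distrib, ← Finset.mul_sum, ← Finset.sum_mul]
  simp
  ring

lemma fder_data {n : ℕ} (c : ℝ) (φ : Spacetime n → ℝ) (q : Spacetime n) (hφ : ContDiffAt ℝ 2 φ q) :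
    HasFDerivAt (fun q => fderiv ℝ φ q) (fderiv ℝ (fderiv ℝ φ) q) q ∧
    (∀ v, HasFDerivAt (fun q => fderiv ℝ φ q v) ((fderiv ℝ (fderiv ℝ φ) q).flip v) q) ∧
    HasFDerivAt (MM c φ) ((fderiv ℝ φ q) + (fderiv ℝ (fderiv ℝ φ) q).flip q + c • fderiv ℝ φ q) q := by
  have h1 : HasFDerivAt (fun q => fderiv ℝ φ q) (fderiv ℝ (fderiv ℝ φ) q) q :=
    ((hφ.fderiv_right (m := 1) (by norm_num)).differentiableAt (by norm_num)).hasFDerivAt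
  have h0 : HasFDerivAt φ (fderiv ℝ φ q) q := (hφ.differentiableAt (by norm_num)).hasFDerivAt
  refine ⟨h1, ?_, ?_⟩
  · intro v
    exact (h1.clm_apply (hasFDerivAt_const v q)).congr_fderiv (by ext w <;> simp)
  · have h3 : HasFDerivAt (MM c φ) _ q := (h1.clm_apply (hasFDerivAt_id q)).add (h0.const_mul c)
    exact h3.congr_fderiv (by ext w <;> simp)

lemma ff_hasFDerivAt {n : ℕ} (q : Spacetime n) :
    ∃ f' : Spacetime n →L[ℝ] ℝ, HasFDerivAt ff f' q ∧
      ∀ v, f' v = (inner ℝ q.2 v.2 - q.1 * v.1) / 2 := by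
  have h1 : HasFDerivAt (fun q : Spacetime n => q.1) (ContinuousLinearMap.fst ℝ ℝ _) q :=
    hasFDerivAt_fst
  have h2 : HasFDerivAt (fun q : Spacetime n => q.2) (ContinuousLinearMap.snd ℝ ℝ _) q :=
    hasFDerivAt_snd
  refine ⟨_, ((h2.norm_sq.sub (h1.pow 2)).mul_const (1/4:ℝ)).congr_of_eventuallyEq ?_, ?_⟩
  · filter_upwards with q; simp [ff]; ring
  · intro v; simp; ring

lemma E_der {n : ℕ} (a c p : ℝ) (hp : 1 ≤ p) (V φ : Spacetime n → ℝ) (q : Spacetime n) (hq : q ∈ Dom n)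
    (hφ : ContDiffAt ℝ 2 φ q) (hV : ContDiffAt ℝ 1 V q) :
    ∃ E' : Spacetime n →L[ℝ] ℝ, HasFDerivAt (EE a c p V φ) E' q ∧
      E' q = -(-(dt φ q) * fderiv ℝ (fderiv ℝ φ) q q (1, 0)
          + ∑ i, dx i φ q * fderiv ℝ (fderiv ℝ φ) q q (0, EuclideanSpace.single i 1))
        + a * c * (φ q * fderiv ℝ φ q q / ff q - φ q ^ 2 / ff q)
        + fderiv ℝ V q q * |φ q| ^ (p + 1) / (p + 1)
        + V q * (|φ q| ^ (p - 1) * φ q) * fderiv ℝ φ q q := by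
  obtain ⟨-, h2, -⟩ := fder_data c φ q hφ
  have h0 : HasFDerivAt φ (fderiv ℝ φ q) q := (hφ.differentiableAt (by norm_num)).hasFDerivAt
  have hV0 : HasFDerivAt V (fderiv ℝ V q) q := (hV.differentiableAt (by norm_num)).hasFDerivAt
  obtain ⟨f', hf, hfv⟩ := ff_hasFDerivAt q
  have hfp := ff_pos hq
  have hfq : f' q = 2 * ff q := by
    rw [hfv, real_inner_self_eq_norm_sq]; unfold ff; ring
  have hab := (hasDerivAt_abs_rpow (φ q) (p := p + 1) (by linarith)).comp_hasFDerivAt q h0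
  have hQ : HasFDerivAt (QQ φ) _ q :=
    ((h2 (1, 0)).pow 2).neg.add (HasFDerivAt.fun_sum (u := Finset.univ) fun i _ => (h2 (0, EuclideanSpace.single i 1)).pow 2)
  have hE : HasFDerivAt (EE a c p V φ) _ q :=
    ((hQ.const_mul (-(1/2))).add (((h0.pow 2).mul ((hasDerivAt_inv hfp.ne').comp_hasFDerivAt q hf)).const_mul (a * c / 2))).add
      ((hV0.mul hab).mul_const ((p + 1)⁻¹))
  refine ⟨_, hE, ?_⟩
  have hpp : p + 1 ≠ 0 := by linarith
  have hp2 : p + 1 - 2 = p - 1 := by ring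
  simp [hfq, dt, dx, hp2]
  simp only [mul_assoc, ← Finset.mul_sum]
  generalize (∑ i, (fderiv ℝ φ q) (0, EuclideanSpace.single i 1) *
    ((fderiv ℝ (fderiv ℝ φ) q) q) (0, EuclideanSpace.single i 1)) = s
  field_simp
  ring

def th (s : ℝ) : ℝ := Real.smoothTransition (2 - s)

lemma th_contDiff : ContDiff ℝ 1 th := by
  have h : ContDiff ℝ ((1 : ℕ∞) : WithTop ℕ∞) Real.smoothTransition := Real.smoothTransition.contDiff
  unfold th
  exact h.comp (by fun_prop)

lemma th_nonneg (s : ℝ) : 0 ≤ th s := Real.smoothTransition.nonneg _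
lemma th_le_one (s : ℝ) : th s ≤ 1 := Real.smoothTransition.le_one _
lemma th_one {s : ℝ} (h : s ≤ 1) : th s = 1 := Real.smoothTransition.one_of_one_le (by linarith)
lemma th_zero {s : ℝ} (h : 2 ≤ s) : th s = 0 := Real.smoothTransition.zero_of_nonpos (by linarith)
lemma th_anti : Antitone th := fun _ _ h => Real.smoothTransition.monotone (by linarith)

lemma th_deriv_nonpos (s : ℝ) : deriv th s ≤ 0 := th_anti.deriv_nonpos

lemma th_deriv_zero {s : ℝ} (h : s < 1) : deriv th s = 0 := by
  have : th =ᶠ[nhds s] fun _ => (1:ℝ) := by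
    filter_upwards [Iio_mem_nhds h] with y hy
    exact th_one (le_of_lt hy)
  rw [this.deriv_eq]; simp

lemma th_deriv_zero' {s : ℝ} (h : 2 < s) : deriv th s = 0 := by
  have : th =ᶠ[nhds s] fun _ => (0:ℝ) := by
    filter_upwards [Ioi_mem_nhds h] with y hy
    exact th_zero (le_of_lt hy)
  rw [this.deriv_eq]; simp

lemma th_deriv_bdd : ∃ L : ℝ, 0 ≤ L ∧ ∀ s, |deriv th s| ≤ L := by
  have hc : Continuous (deriv th) := th_contDiff.continuous_deriv (by norm_num)
  obtain ⟨L, hL⟩ := (isCompact_Icc (a := (1:ℝ)) (b := 2)).exists_bound_of_continuousOn hc.continuousOn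
  have hL0 : 0 ≤ L := (norm_nonneg _).trans (hL 1 (by norm_num))
  refine ⟨L, hL0, fun s => ?_⟩
  by_cases h1 : s < 1
  · rw [th_deriv_zero h1]; simpa
  by_cases h2 : 2 < s
  · rw [th_deriv_zero' h2]; simpa
  · exact hL s ⟨by linarith, by linarith⟩

def Wt {n : ℕ} (a k : ℝ) (q : Spacetime n) : ℝ :=
  th (-log (ff q) / k) * th (log (‖q.2‖ ^ 2) / k) * ff q ^ (2 * a)

def be {n : ℕ} (a k : ℝ) (q : Spacetime n) : ℝ :=
  -deriv th (-log (ff q) / k) / (k * ff q) * th (log (‖q.2‖ ^ 2) / k) * ff q ^ (2 * a)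

def ga {n : ℕ} (a k : ℝ) (q : Spacetime n) : ℝ :=
  th (-log (ff q) / k) * (deriv th (log (‖q.2‖ ^ 2) / k) / (k * ‖q.2‖ ^ 2)) * ff q ^ (2 * a)

lemma norm_pos_of {n : ℕ} {q : Spacetime n} (hq : q ∈ Dom n) : 0 < ‖q.2‖ :=
  lt_of_le_of_lt (abs_nonneg q.1) hq

lemma Wt_der {n : ℕ} (a k : ℝ) (hk : 0 < k) (q : Spacetime n) (hq : q ∈ Dom n) :
    ∃ w' : Spacetime n →L[ℝ] ℝ, HasFDerivAt (Wt a k) w' q ∧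
      ∀ v, w' v = (be a k q + 2 * a * Wt a k q / ff q) * ((inner ℝ q.2 v.2 - q.1 * v.1) / 2)
        + ga a k q * (2 * inner ℝ q.2 v.2) := by
  obtain ⟨f', hf, hfv⟩ := ff_hasFDerivAt q
  have hfp := ff_pos hq
  have hr := norm_pos_of hq
  have h2 : HasFDerivAt (fun q : Spacetime n => q.2) (ContinuousLinearMap.snd ℝ ℝ _) q :=
    hasFDerivAt_snd
  have hth : ∀ s, HasDerivAt th (deriv th s) s := fun s =>
    (th_contDiff.differentiable (by norm_num) s).hasDerivAt
  have hR : HasFDerivAt (fun q : Spacetime n => ‖q.2‖ ^ 2) _ q := h2.norm_sq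
  have hl1 := ((hasDerivAt_log hfp.ne').comp_hasFDerivAt q hf).neg.mul_const (k⁻¹)
  have hl2 := ((hasDerivAt_log (show ‖q.2‖ ^ 2 ≠ 0 by positivity)).comp_hasFDerivAt q hR).mul_const (k⁻¹)
  have ht1 := (hth (-log (ff q) / k)).comp_hasFDerivAt q hl1
  have ht2 := (hth (log (‖q.2‖ ^ 2) / k)).comp_hasFDerivAt q hl2
  have hp := (Real.hasDerivAt_rpow_const (x := ff q) (p := 2 * a) (Or.inl hfp.ne')).comp_hasFDerivAt q hf
  have hw : HasFDerivAt (Wt a k) _ q := (ht1.mul ht2).mul hp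
  refine ⟨_, hw, fun v => ?_⟩
  rw [Real.rpow_sub_one hfp.ne']
  simp [hfv, Wt, be, ga, ← div_eq_mul_inv]
  field_simp
  ring

def J0 {n : ℕ} (a c p : ℝ) (V φ : Spacetime n → ℝ) (q : Spacetime n) : ℝ :=
  -(dt φ q) * MM c φ q + q.1 * EE a c p V φ q

def JX {n : ℕ} (a c p : ℝ) (V φ : Spacetime n → ℝ) (i : Fin n) (q : Spacetime n) : ℝ :=
  dx i φ q * MM c φ q + q.2 i * EE a c p V φ q

lemma div_identity {n : ℕ} (hn : 2 ≤ n) (a c p k : ℝ) (hc : c = ((n:ℝ) - 1) / 2 + 2 * a) (hk : 0 < k) (hp : 1 ≤ p)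
    (V φ : Spacetime n → ℝ) (q : Spacetime n) (hq : q ∈ Dom n)
    (hφ : ContDiffAt ℝ 2 φ q) (hV : ContDiffAt ℝ 1 V q)
    (heq : box φ q + V q * |φ q| ^ (p - 1) * φ q = 0) :
    fderiv ℝ (fun q => Wt a k q * J0 a c p V φ q) q (1, 0) +
      ∑ i, fderiv ℝ (fun q => Wt a k q * JX a c p V φ i q) q (0, EuclideanSpace.single i 1)
    = Wt a k q * (a / ff q * MM c φ q ^ 2 +
        (fderiv ℝ V q q + (((n:ℝ) - 1) / 2 * (1 + 4 / ((n:ℝ) - 1) - p) - 2 * a * (p - 1)) * V q) / (p + 1)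
          * |φ q| ^ (p + 1))
      + be a k q * (1 / 2 * fderiv ℝ φ q q * MM c φ q + 2 * ff q * EE a c p V φ q)
      + 2 * ga a k q * ((∑ i, q.2 i * dx i φ q) * MM c φ q + ‖q.2‖ ^ 2 * EE a c p V φ q) := by
  obtain ⟨w', hw, hwv⟩ := Wt_der a k hk q hq
  obtain ⟨-, h2, hM⟩ := fder_data c φ q hφ
  obtain ⟨E', hE, hEq⟩ := E_der a c p hp V φ q hq hφ hV
  have hfp := ff_pos hq
  have key := div_abstract q (Wt a k) (MM c φ) (EE a c p V φ) (dt φ) (fun i => dx i φ) w' _ E' _ _ hw hM hE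
    (h2 (1, 0)) (fun i => h2 (0, EuclideanSpace.single i 1))
  have hsymm : IsSymmSndFDerivAt ℝ φ q := hφ.isSymmSndFDerivAt (by simp)
  have hbox : box φ q = -((fderiv ℝ (fderiv ℝ φ) q).flip (1, 0)) (1, 0)
      + ∑ i, ((fderiv ℝ (fderiv ℝ φ) q).flip (0, EuclideanSpace.single i 1)) (0, EuclideanSpace.single i 1) := by
    unfold box
    congr 1
    · unfold dt
      rw [(h2 (1, 0)).fderiv]
    · apply Finset.sum_congr rfl
      intro i _
      unfold dx
      rw [(h2 (0, EuclideanSpace.single i 1)).fderiv]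
  rw [← hbox] at key
  have hS := vec_decomp q (fderiv ℝ φ q)
  change fderiv ℝ φ q q = q.1 * dt φ q + ∑ i, q.2 i * dx i φ q at hS
  have hR : ‖q.2‖ ^ 2 = ∑ i, q.2 i * q.2 i := by
    rw [EuclideanSpace.norm_sq_eq]; simp [sq]
  unfold J0 JX
  rw [key]
  have hw0 : w' (1, 0) = (be a k q + 2 * a * Wt a k q / ff q) * (- q.1 / 2) := by
    rw [hwv]; simp
  have hwi : ∀ i, w' (0, EuclideanSpace.single i 1) = ((be a k q + 2 * a * Wt a k q / ff q) / 2 + 2 * ga a k q) * q.2 i := by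
    intro i; rw [hwv]
    have : inner ℝ q.2 (EuclideanSpace.single i (1:ℝ)) = q.2 i := by
      simp [EuclideanSpace.inner_single_right]
    simp [this]; ring
  have s1 : ∑ i, w' (0, EuclideanSpace.single i 1) * (dx i φ q * MM c φ q + q.2 i * EE a c p V φ q)
      = ((be a k q + 2 * a * Wt a k q / ff q) / 2 + 2 * ga a k q) *
        ((∑ i, q.2 i * dx i φ q) * MM c φ q + ‖q.2‖ ^ 2 * EE a c p V φ q) := by
    rw [hR, Finset.sum_mul, Finset.sum_mul, ← Finset.sum_add_distrib, Finset.mul_sum]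
    apply Finset.sum_congr rfl
    intro i _
    rw [hwi]; ring
  have s2 : ∑ i, dx i φ q * (fderiv ℝ φ q + (fderiv ℝ (fderiv ℝ φ) q).flip q + c • fderiv ℝ φ q) (0, EuclideanSpace.single i 1)
      = (1 + c) * ∑ i, dx i φ q ^ 2 + ∑ i, dx i φ q * fderiv ℝ (fderiv ℝ φ) q q (0, EuclideanSpace.single i 1) := by
    rw [Finset.mul_sum, ← Finset.sum_add_distrib]
    apply Finset.sum_congr rfl
    intro i _
    have := hsymm (0, EuclideanSpace.single i 1) q
    simp [this, dx]; ring
  have s3 : (fderiv ℝ φ q + (fderiv ℝ (fderiv ℝ φ) q).flip q + c • fderiv ℝ φ q) (1, 0)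
      = (1 + c) * dt φ q + fderiv ℝ (fderiv ℝ φ) q q (1, 0) := by
    have := hsymm (1, 0) q
    simp [this, dt]; ring
  rw [s1, s2, s3, hw0, hEq]
  have hpow : |φ q| ^ (p + 1) = |φ q| ^ (p - 1) * φ q * φ q := by
    have : p + 1 = (p - 1) + 2 := by ring
    rw [this, Real.rpow_add_of_nonneg (abs_nonneg _) (by linarith) (by norm_num)]
    norm_num
    ring
  have hb : box φ q = - (V q * |φ q| ^ (p - 1) * φ q) := by linarith
  rw [hb, hpow]
  have hEdef : EE a c p V φ q = -(1 / 2) * QQ φ q + a * c / 2 * (φ q ^ 2 / ff q) + V q * (|φ q| ^ (p - 1) * φ q * φ q) / (p + 1) := by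
    rw [← hpow]; rfl
  have hMdef : MM c φ q = fderiv ℝ φ q q + c * φ q := rfl
  have hff : ‖q.2‖ ^ 2 = 4 * ff q + q.1 ^ 2 := by unfold ff; ring
  have hQdef : QQ φ q = -(dt φ q) ^ 2 + ∑ i, (dx i φ q) ^ 2 := rfl
  have hsQ : ∑ i, (dx i φ q) ^ 2 = QQ φ q + dt φ q ^ 2 := by linarith
  have hsS : ∑ i, q.2 i * dx i φ q = fderiv ℝ φ q q - q.1 * dt φ q := by linarith
  rw [hff, hsQ, hsS, hEdef, hMdef, hc]
  have hn1 : (n:ℝ) - 1 ≠ 0 := by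
    have : (2:ℝ) ≤ n := by exact_mod_cast hn
    intro h; linarith
  have hpp : p + 1 ≠ 0 := by linarith
  generalize (∑ i, dx i φ q * fderiv ℝ (fderiv ℝ φ) q q (0, EuclideanSpace.single i 1)) = s
  generalize |φ q| ^ (p - 1) = z
  field_simp
  ring

lemma num_est (c C K z A B M y fa e g N : ℝ) (hC : 0 ≤ C) (hz : 0 ≤ z)
    (hAB : |A| + |B| ≤ C * z) (hy : |y| ≤ C * z) (hM : M = A + B + c * y)
    (hN0 : 0 ≤ N) (hN : N ≤ K * z ^ 2) (hfa : 0 ≤ fa) (he : |e| ≤ |A| + |B|) :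
    e * M + (-(1/2) * (A * B + fa) + g * y ^ 2 + N)
      ≤ (C ^ 2 * (2 + |c| + |g|) + K) * z ^ 2 ∧
    (fa ≤ C ^ 2 * z ^ 2 → |1 / 2 * (A + B) * M + 2 * (-(1/2) * (A * B + fa) + g * y ^ 2 + N)|
      ≤ 2 * (C ^ 2 * (3 + |c| + |g|) + K) * z ^ 2) := by
  have hCz : 0 ≤ C * z := by positivity
  have hM' : |M| ≤ (1 + |c|) * (C * z) := by
    rw [hM]
    calc |A + B + c * y| ≤ |A| + |B| + |c| * |y| := by
          rw [← abs_mul]; exact (abs_add_le _ _).trans (by gcongr; exact abs_add_le _ _)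
      _ ≤ C * z + |c| * (C * z) := by gcongr
      _ = _ := by ring
  have h1 : |e * M| ≤ (C * z) * ((1 + |c|) * (C * z)) := by
    rw [abs_mul]; exact mul_le_mul (he.trans hAB) hM' (abs_nonneg _) hCz
  have h1' : |(A + B) * M| ≤ (C * z) * ((1 + |c|) * (C * z)) := by
    rw [abs_mul]; exact mul_le_mul ((abs_add_le _ _).trans hAB) hM' (abs_nonneg _) hCz
  have h2 : |A * B| ≤ (C * z) * (C * z) := by
    rw [abs_mul]
    exact mul_le_mul (by linarith [abs_nonneg B]) (by linarith [abs_nonneg A]) (abs_nonneg _) hCz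
  have h3 : |g * y ^ 2| ≤ |g| * ((C * z) * (C * z)) := by
    rw [abs_mul, abs_pow, sq]
    gcongr
  have h4 : 0 ≤ C ^ 2 * z ^ 2 := by positivity
  constructor
  · have := (abs_le.1 h1).2
    have := (abs_le.1 h2).1
    have := (abs_le.1 h3).2
    nlinarith
  · intro hf
    have a1 := abs_le.1 h1'
    have a2 := abs_le.1 h2
    have a3 := abs_le.1 h3
    have h5 : 0 ≤ C ^ 2 * z ^ 2 * |c| := by positivity
    have h6 : 0 ≤ C ^ 2 * z ^ 2 * |g| := by positivity
    rw [abs_le]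
    constructor <;> nlinarith

set_option maxHeartbeats 1000000 in
lemma estimates {n : ℕ} (hn : 2 ≤ n) (a c p δ : ℝ) (hδ : 0 < δ) (hp1 : 1 ≤ p)
    (V φ : Spacetime n → ℝ)
    (hVbd : ∃ C : ℝ, ∀ q ∈ Dom n, |V q| ≤ C)
    (hVpos : ∀ q ∈ Dom n, 0 < V q)
    (hdec : Dec δ φ)
    (hextra : ∃ C : ℝ, ∀ q ∈ Dom n, 1 < |uu q * vv q| →
      ((1 + |uu q|) * (1 + |vv q|)) ^ (((n : ℝ) - 1 + δ) / (p + 1)) *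
        |uu q * vv q| ^ (1 / (p + 1)) * (V q) ^ (1 / (p + 1)) * |φ q| ≤ C) :
    ∃ C : ℝ, 0 ≤ C ∧ ∀ q ∈ Dom n,
      ff q * ((∑ i, q.2 i * dx i φ q) / ‖q.2‖ ^ 2 * MM c φ q + EE a c p V φ q) ≤
        C * ((1 + |uu q|) * (1 + |vv q|)) ^ (-((n : ℝ) - 1 + δ)) ∧
      (ff q < 1 → |1 / 2 * fderiv ℝ φ q q * MM c φ q + 2 * ff q * EE a c p V φ q| ≤
        C * ((1 + |uu q|) * (1 + |vv q|)) ^ (-((n : ℝ) - 1 + δ))) := by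
  obtain ⟨⟨C1, h1⟩, ⟨C2, h2⟩, ⟨C3, h3⟩⟩ := hdec
  obtain ⟨CV, hCV⟩ := hVbd
  obtain ⟨Ce, he⟩ := hextra
  have hn' : (2:ℝ) ≤ n := by exact_mod_cast hn
  set C := |C1| + |C2| + |C3| with hCdef
  have hC : 0 ≤ C := by positivity
  have hC1 : C1 ≤ C := by linarith [le_abs_self C1, abs_nonneg C2, abs_nonneg C3]
  have hC2 : C2 ≤ C := by linarith [le_abs_self C2, abs_nonneg C1, abs_nonneg C3]
  have hC3 : C3 ≤ C := by linarith [le_abs_self C3, abs_nonneg C2, abs_nonneg C1]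
  set K := |CV| * (C ^ (p - 1) * C ^ 2) + |Ce| ^ (p + 1) with hK
  have hK0 : 0 ≤ K := by positivity
  refine ⟨2 * (C ^ 2 * (3 + |c| + |a * c / 2|) + K), by positivity, fun q hq => ?_⟩
  have hfp := ff_pos hq
  have hr := norm_pos_of hq
  have hab : |uu q * vv q| = ff q := by rw [ff_eq, abs_of_neg]; have := ff_eq q; linarith
  have g1 := h1 q hq
  have g2 := h2 q hq
  have g3 := h3 q hq
  have ge := he q hq
  have gV := hCV q hq
  have hVp := hVpos q hq
  rw [hab] at g2 ge
  have hW1 : 1 ≤ (1 + |uu q|) * (1 + |vv q|) := by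
    nlinarith [abs_nonneg (uu q), abs_nonneg (vv q), mul_nonneg (abs_nonneg (uu q)) (abs_nonneg (vv q))]
  generalize (1 + |uu q|) * (1 + |vv q|) = W at *
  have hW0 : 0 < W := by linarith
  set z := W ^ (-(((n:ℝ) - 1 + δ) / 2)) with hz
  have hzp : 0 < z := by positivity
  have hz1 : z ≤ 1 := Real.rpow_le_one_of_one_le_of_nonpos hW1 (by linarith)
  have hzz : W ^ (-((n:ℝ) - 1 + δ)) = z ^ 2 := by
    rw [hz, ← Real.rpow_natCast, ← Real.rpow_mul hW0.le]; congr 1; push_cast; ring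
  have hzW : z * W ^ (((n:ℝ) - 1 + δ) / 2) = 1 := by
    rw [hz, ← Real.rpow_add hW0]; simp
  have conv : ∀ y D : ℝ, D ≤ C → W ^ (((n:ℝ) - 1 + δ) / 2) * y ≤ D → y ≤ C * z := by
    intro y D hD h
    calc y = z * (W ^ (((n:ℝ) - 1 + δ) / 2) * y) := by rw [← mul_assoc, hzW, one_mul]
      _ ≤ z * C := by gcongr; linarith
      _ = C * z := mul_comm _ _
  have b1 := conv _ _ hC1 g1
  have b3 := conv _ _ hC3 g3
  rw [hzz]
  set y := φ q
  have hNp : |y| ^ (p + 1) = |y| ^ (p - 1) * y ^ 2 := by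
    have : p + 1 = (p - 1) + 2 := by ring
    rw [this, Real.rpow_add_of_nonneg (abs_nonneg _) (by linarith) (by norm_num)]
    norm_num
  have hN : ff q * (V q * |y| ^ (p + 1)) ≤ K * z ^ 2 := by
    by_cases hf1 : ff q ≤ 1
    · have e1 : |y| ^ (p - 1) ≤ C ^ (p - 1) := by
        apply Real.rpow_le_rpow (abs_nonneg _) _ (by linarith)
        nlinarith
      have e2 : y ^ 2 ≤ C ^ 2 * z ^ 2 := by
        rw [← sq_abs, ← mul_pow]; gcongr
      have e3 : V q ≤ |CV| := (le_abs_self _).trans (gV.trans (le_abs_self _))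
      calc ff q * (V q * |y| ^ (p + 1)) ≤ 1 * (|CV| * (C ^ (p - 1) * (C ^ 2 * z ^ 2))) := by
            rw [hNp]; gcongr
        _ ≤ K * z ^ 2 := by
            rw [hK]
            have : 0 ≤ |Ce| ^ (p + 1) * z ^ 2 := by positivity
            linarith
    · push Not at hf1
      have ge' := ge hf1
      have hpp : 0 < p + 1 := by linarith
      have hY : 0 ≤ W ^ (((n:ℝ) - 1 + δ) / (p + 1)) * ff q ^ (1 / (p + 1)) * V q ^ (1 / (p + 1)) * |y| := by
        positivity
      have := Real.rpow_le_rpow hY (ge'.trans (le_abs_self Ce)) hpp.le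
      rw [Real.mul_rpow (by positivity) (by positivity), Real.mul_rpow (by positivity) (by positivity),
        Real.mul_rpow (by positivity) (by positivity), ← Real.rpow_mul hW0.le, ← Real.rpow_mul hfp.le,
        ← Real.rpow_mul hVp.le, div_mul_cancel₀ _ hpp.ne', div_mul_cancel₀ _ hpp.ne', Real.rpow_one, Real.rpow_one] at this
      have hzW2 : z ^ 2 * W ^ ((n:ℝ) - 1 + δ) = 1 := by
        rw [← hzz, ← Real.rpow_add hW0, neg_add_cancel, Real.rpow_zero]
      calc ff q * (V q * |y| ^ (p + 1)) = z ^ 2 * (W ^ ((n:ℝ) - 1 + δ) * ff q * V q * |y| ^ (p + 1)) := by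
            linear_combination (-(ff q * (V q * |y| ^ (p + 1)))) * hzW2
        _ ≤ z ^ 2 * |Ce| ^ (p + 1) := by gcongr
        _ ≤ K * z ^ 2 := by
            rw [hK]
            have : 0 ≤ |CV| * (C ^ (p - 1) * C ^ 2) * z ^ 2 := by positivity
            linarith
  have hN0 : 0 ≤ ff q * (V q * |y| ^ (p + 1)) := by positivity
  have hN' : ff q * (V q * |y| ^ (p + 1)) / (p + 1) ≤ K * z ^ 2 :=
    (div_le_self hN0 (by linarith)).trans hN
  have hS := vec_decomp q (fderiv ℝ φ q)
  change fderiv ℝ φ q q = q.1 * dt φ q + ∑ i, q.2 i * dx i φ q at hS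
  have hP : ∑ i, q.2 i * dx i φ q = ‖q.2‖ * dr φ q := by unfold dr; field_simp
  have hang : 0 ≤ angSq φ q := by
    have cs := Finset.sum_mul_sq_le_sq_mul_sq Finset.univ (fun i => q.2 i) (fun i => dx i φ q)
    have hR : ∑ i, q.2 i ^ 2 = ‖q.2‖ ^ 2 := by rw [EuclideanSpace.norm_sq_eq]; simp
    rw [hR, hP, mul_pow] at cs
    have := le_of_mul_le_mul_left cs (by positivity)
    unfold angSq; linarith
  have hQ : ff q * QQ φ q = uu q * du φ q * (vv q * dv φ q) + ff q * angSq φ q := by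
    rw [ff_eq]; unfold QQ angSq du dv; ring
  have hM : MM c φ q = uu q * du φ q + vv q * dv φ q + c * y := by
    have : MM c φ q = fderiv ℝ φ q q + c * y := rfl
    rw [this, hS, hP]; unfold uu vv du dv; ring
  have hS' : fderiv ℝ φ q q = uu q * du φ q + vv q * dv φ q := by
    rw [hS, hP]; unfold uu vv du dv; ring
  have hE : ff q * EE a c p V φ q = -(1/2) * (uu q * du φ q * (vv q * dv φ q) + ff q * angSq φ q)
      + a * c / 2 * y ^ 2 + ff q * (V q * |y| ^ (p + 1)) / (p + 1) := by
    rw [← hQ]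
    have : EE a c p V φ q = -(1 / 2) * QQ φ q + a * c / 2 * (y ^ 2 / ff q) + V q * |y| ^ (p + 1) / (p + 1) := rfl
    rw [this]; field_simp
  have hq' : |q.1| < ‖q.2‖ := hq
  have hu : |uu q| ≤ ‖q.2‖ := by
    have := abs_lt.1 hq'
    unfold uu; rw [abs_le]; constructor <;> linarith
  have hv : |vv q| ≤ ‖q.2‖ := by
    have := abs_lt.1 hq'
    unfold vv; rw [abs_le]; constructor <;> linarith
  have hee : |ff q * ((∑ i, q.2 i * dx i φ q) / ‖q.2‖ ^ 2)| ≤ |uu q * du φ q| + |vv q * dv φ q| := by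
    have e : ff q * ((∑ i, q.2 i * dx i φ q) / ‖q.2‖ ^ 2)
        = (vv q * (uu q * du φ q) - uu q * (vv q * dv φ q)) / (2 * ‖q.2‖) := by
      rw [hP, ff_eq]; unfold du dv; field_simp; ring
    rw [e, abs_div, div_le_iff₀ (by positivity), abs_of_pos (show 0 < 2 * ‖q.2‖ by positivity)]
    calc _ ≤ |vv q| * |uu q * du φ q| + |uu q| * |vv q * dv φ q| := by
          rw [← abs_mul, ← abs_mul]; exact abs_sub _ _
      _ ≤ ‖q.2‖ * |uu q * du φ q| + ‖q.2‖ * |vv q * dv φ q| := by gcongr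
      _ ≤ _ := by
        have : 0 ≤ ‖q.2‖ * (|uu q * du φ q| + |vv q * dv φ q|) := by positivity
        linarith
  have main := num_est c C K z (uu q * du φ q) (vv q * dv φ q) (MM c φ q) y (ff q * angSq φ q)
    (ff q * ((∑ i, q.2 i * dx i φ q) / ‖q.2‖ ^ 2)) (a * c / 2) (ff q * (V q * |y| ^ (p + 1)) / (p + 1))
    hC hzp.le b1 b3 hM (by positivity) hN' (by positivity) hee
  constructor
  · rw [mul_add, hE, ← mul_assoc]
    refine main.1.trans ?_
    apply mul_le_mul_of_nonneg_right _ (sq_nonneg z)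
    have h7 : 0 ≤ C ^ 2 * (2 + |c| + |a * c / 2|) + K := by positivity
    have h8 : C ^ 2 * (3 + |c| + |a * c / 2|) = C ^ 2 * (2 + |c| + |a * c / 2|) + C ^ 2 := by ring
    have h9 := sq_nonneg C
    linarith
  · intro hf1
    have b2 := conv (ff q ^ ((1:ℝ)/2) * Real.sqrt (angSq φ q)) C2 hC2 (by rw [← mul_assoc]; exact g2 hf1)
    have hfa : ff q * angSq φ q ≤ C ^ 2 * z ^ 2 := by
      rw [← Real.sqrt_eq_rpow] at b2
      have := pow_le_pow_left₀ (by positivity) b2 2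
      rwa [mul_pow, mul_pow, Real.sq_sqrt hfp.le, Real.sq_sqrt hang] at this
    have := main.2 hfa
    rw [hS', mul_assoc 2, hE]
    exact this

lemma cpt_ext {n : ℕ} (F : Spacetime n → ℝ) (D K : Set (Spacetime n)) (hD : IsOpen D)
    (hK : IsCompact K) (hKD : K ⊆ D) (hF : ContDiffOn ℝ 1 F D) (h0 : ∀ q, q ∉ K → F q = 0) :
    Continuous F ∧ HasCompactSupport F := by
  have hsub : Function.support F ⊆ K := by
    intro q hq
    by_contra h
    exact hq (h0 q h)
  refine ⟨?_, HasCompactSupport.of_support_subset_isCompact hK hsub⟩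
  rw [continuous_iff_continuousAt]
  intro x
  by_cases hx : x ∈ D
  · exact (hF.contDiffAt (hD.mem_nhds hx)).continuousAt
  · have hxK : x ∈ Kᶜ := fun h => hx (hKD h)
    have he : F =ᶠ[nhds x] fun _ => (0:ℝ) := by
      filter_upwards [hK.isClosed.isOpen_compl.mem_nhds hxK] with y hy
      exact h0 y hy
    exact continuousAt_const.congr he.symm

def Kc (n : ℕ) (k : ℝ) : Set (Spacetime n) := {q | exp (-(2 * k)) ≤ ff q ∧ ‖q.2‖ ^ 2 ≤ exp (2 * k)}

lemma Kc_sub (n : ℕ) (k : ℝ) : Kc n k ⊆ Dom n := by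
  intro q hq
  have h : 0 < ff q := lt_of_lt_of_le (exp_pos _) hq.1
  change |q.1| < ‖q.2‖
  apply abs_lt_of_sq_lt_sq _ (norm_nonneg _)
  unfold ff at h; linarith

lemma ff_cont (n : ℕ) : ContDiff ℝ 1 (ff : Spacetime n → ℝ) := by
  have h : ContDiff ℝ 1 (fun q : Spacetime n => ‖q.2‖ ^ 2) := contDiff_snd.norm_sq ℝ
  have h2 : ContDiff ℝ 1 (fun q : Spacetime n => q.1) := contDiff_fst
  unfold ff
  exact (h.sub (h2.pow 2)).div_const 4

lemma Kc_compact (n : ℕ) (k : ℝ) : IsCompact (Kc n k) := by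
  apply Metric.isCompact_of_isClosed_isBounded
  · apply IsClosed.inter
    · exact isClosed_le continuous_const (ff_cont n).continuous
    · exact isClosed_le (f := fun q : Spacetime n => ‖q.2‖ ^ 2) (by fun_prop) continuous_const
  · rw [isBounded_iff_forall_norm_le]
    refine ⟨exp k, fun q hq => ?_⟩
    have hd : |q.1| < ‖q.2‖ := Kc_sub n k hq
    have h2 : ‖q.2‖ ≤ exp k := by
      have h3 := hq.2
      rw [show 2 * k = k + k by ring, exp_add] at h3
      nlinarith [exp_pos k, norm_nonneg q.2]
    rw [Prod.norm_def]
    exact max_le (by rw [Real.norm_eq_abs]; linarith) h2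

lemma Wt_zero {n : ℕ} (a k : ℝ) (hk : 0 < k) (q : Spacetime n) (hq : q ∈ Dom n) (hK : q ∉ Kc n k) :
    Wt a k q = 0 := by
  have hfp := ff_pos hq
  have hr := norm_pos_of hq
  unfold Wt
  by_cases h : exp (-(2 * k)) ≤ ff q
  · have h2 : exp (2 * k) < ‖q.2‖ ^ 2 := by
      by_contra h3
      exact hK ⟨h, not_lt.1 h3⟩
    have : 2 * k < log (‖q.2‖ ^ 2) := (lt_log_iff_exp_lt (by positivity)).2 h2
    rw [th_zero (s := log (‖q.2‖ ^ 2) / k) (by rw [le_div_iff₀ hk]; linarith)]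
    simp
  · have : log (ff q) < -(2 * k) := (log_lt_iff_lt_exp hfp).2 (not_le.1 h)
    rw [th_zero (s := -log (ff q) / k) (by rw [le_div_iff₀ hk]; linarith)]
    simp

lemma Wt_smooth {n : ℕ} (a k : ℝ) (q : Spacetime n) (hq : q ∈ Dom n) : ContDiffAt ℝ 1 (Wt a k) q := by
  have hfp := ff_pos hq
  have hr := norm_pos_of hq
  have h1 : ContDiffAt ℝ 1 (ff : Spacetime n → ℝ) q := (ff_cont n).contDiffAt
  have h2 : ContDiffAt ℝ 1 (fun q : Spacetime n => ‖q.2‖ ^ 2) q := (contDiff_snd.norm_sq ℝ).contDiffAt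
  have l1 := (h1.log hfp.ne').neg.div_const k
  have l2 := (h2.log (by positivity)).div_const k
  exact ((th_contDiff.contDiffAt.comp q l1).mul (th_contDiff.contDiffAt.comp q l2)).mul
    (h1.rpow_const_of_ne hfp.ne')

lemma pow_smooth {n : ℕ} (p : ℝ) (hp : 1 ≤ p) (V φ : Spacetime n → ℝ) (q : Spacetime n)
    (hφ : ContDiffAt ℝ 2 φ q) (hV : ContDiffAt ℝ 1 V q) :
    ContDiffAt ℝ 1 (fun q => V q * |φ q| ^ (p + 1)) q := by
  have h : ContDiff ℝ 1 (fun x : ℝ => ‖x‖ ^ (p + 1)) := contDiff_norm_rpow (by linarith)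
  exact hV.mul (h.contDiffAt.comp q (hφ.of_le (by norm_num)))

lemma J_smooth {n : ℕ} (a c p : ℝ) (hp : 1 ≤ p) (V φ : Spacetime n → ℝ) (q : Spacetime n) (hq : q ∈ Dom n)
    (hφ : ContDiffAt ℝ 2 φ q) (hV : ContDiffAt ℝ 1 V q) :
    ContDiffAt ℝ 1 (J0 a c p V φ) q ∧ ∀ i, ContDiffAt ℝ 1 (JX a c p V φ i) q := by
  have hfp := ff_pos hq
  have h1 : ContDiffAt ℝ 1 (ff : Spacetime n → ℝ) q := (ff_cont n).contDiffAt
  have h0 : ContDiffAt ℝ 1 φ q := hφ.of_le (by norm_num)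
  have hd : ContDiffAt ℝ 1 (fun q => fderiv ℝ φ q) q := hφ.fderiv_right (m := 1) (by norm_num)
  have ht : ContDiffAt ℝ 1 (dt φ) q := hd.clm_apply contDiffAt_const
  have hx : ∀ i, ContDiffAt ℝ 1 (dx i φ) q := fun i => hd.clm_apply contDiffAt_const
  have hM : ContDiffAt ℝ 1 (MM c φ) q := (hd.clm_apply contDiffAt_id).add (contDiffAt_const.mul h0)
  have hQ : ContDiffAt ℝ 1 (QQ φ) q := (ht.pow 2).neg.add (ContDiffAt.sum fun i _ => (hx i).pow 2)
  have hE : ContDiffAt ℝ 1 (EE a c p V φ) q :=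
    ((contDiffAt_const.mul hQ).add (contDiffAt_const.mul ((h0.pow 2).div h1 hfp.ne'))).add
      ((pow_smooth p hp V φ q hφ hV).div_const _)
  have hq1 : ContDiffAt ℝ 1 (fun q : Spacetime n => q.1) q := contDiffAt_fst
  have hq2 : ∀ i, ContDiffAt ℝ 1 (fun q : Spacetime n => q.2 i) q := fun i => by fun_prop
  exact ⟨(ht.neg.mul hM).add (hq1.mul hE), fun i => ((hx i).mul hM).add ((hq2 i).mul hE)⟩

lemma th_mono_k {k k' s : ℝ} (hk : 0 < k) (hkk : k ≤ k') : th (s / k) ≤ th (s / k') := by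
  have hk' : 0 < k' := by linarith
  by_cases hs : 0 ≤ s
  · exact th_anti (by gcongr)
  · rw [th_one (s := s / k')]
    · exact th_le_one _
    · have : s / k' ≤ 0 := div_nonpos_of_nonpos_of_nonneg (by linarith) hk'.le
      linarith

lemma Wt_nonneg {n : ℕ} (a k : ℝ) (q : Spacetime n) (hq : q ∈ Dom n) : 0 ≤ Wt a k q := by
  have := ff_pos hq
  have h1 := th_nonneg (-log (ff q) / k)
  have h2 := th_nonneg (log (‖q.2‖ ^ 2) / k)
  unfold Wt; positivity

lemma err_bound {n : ℕ} (a c p δ k L C : ℝ) (hk : 0 < k) (V φ : Spacetime n → ℝ)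
    (hL : ∀ s, |deriv th s| ≤ L) (hC : 0 ≤ C) (q : Spacetime n) (hq : q ∈ Dom n)
    (h1 : ff q * ((∑ i, q.2 i * dx i φ q) / ‖q.2‖ ^ 2 * MM c φ q + EE a c p V φ q) ≤
        C * ((1 + |uu q|) * (1 + |vv q|)) ^ (-((n : ℝ) - 1 + δ)))
    (h2 : ff q < 1 → |1 / 2 * fderiv ℝ φ q q * MM c φ q + 2 * ff q * EE a c p V φ q| ≤
        C * ((1 + |uu q|) * (1 + |vv q|)) ^ (-((n : ℝ) - 1 + δ))) :
    -(3 * L * C / k * HH n (2 * a) δ q) ≤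
      be a k q * (1 / 2 * fderiv ℝ φ q q * MM c φ q + 2 * ff q * EE a c p V φ q)
      + 2 * ga a k q * ((∑ i, q.2 i * dx i φ q) * MM c φ q + ‖q.2‖ ^ 2 * EE a c p V φ q) := by
  have hfp := ff_pos hq
  have hr := norm_pos_of hq
  have hL0 : 0 ≤ L := (abs_nonneg _).trans (hL 0)
  have hH : HH n (2 * a) δ q = ff q ^ (2 * a) / ff q * ((1 + |uu q|) * (1 + |vv q|)) ^ (-((n : ℝ) - 1 + δ)) := by
    unfold HH
    rw [Set.indicator_of_mem hq, ← ff_eq, Real.rpow_sub_one hfp.ne']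
  rw [hH]
  have hZ : 0 ≤ ((1 + |uu q|) * (1 + |vv q|)) ^ (-((n : ℝ) - 1 + δ)) := by positivity
  generalize ((1 + |uu q|) * (1 + |vv q|)) ^ (-((n : ℝ) - 1 + δ)) = Z at *
  set F := ff q ^ (2 * a) with hF
  have hF0 : 0 < F := by positivity
  have p1 : -(L * C / k * (F / ff q * Z)) ≤
      be a k q * (1 / 2 * fderiv ℝ φ q q * MM c φ q + 2 * ff q * EE a c p V φ q) := by
    by_cases hf1 : ff q < 1
    · have hb : |be a k q| ≤ L / (k * ff q) * 1 * F := by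
        unfold be
        rw [abs_mul, abs_mul, abs_div, abs_neg, abs_of_pos (show 0 < k * ff q by positivity),
          abs_of_nonneg (th_nonneg _), abs_of_pos hF0]
        gcongr
        · have := th_nonneg (log (‖q.2‖ ^ 2) / k); positivity
        · exact hL _
        · exact th_le_one _
      have hm : |be a k q * (1 / 2 * fderiv ℝ φ q q * MM c φ q + 2 * ff q * EE a c p V φ q)|
          ≤ (L / (k * ff q) * 1 * F) * (C * Z) := by
        rw [abs_mul]
        exact mul_le_mul hb (h2 hf1) (abs_nonneg _) (by positivity)
      have := (abs_le.1 hm).1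
      calc _ = -((L / (k * ff q) * 1 * F) * (C * Z)) := by field_simp
        _ ≤ _ := this
    · have hlog : 0 ≤ log (ff q) := log_nonneg (not_lt.1 hf1)
      have hb : be a k q = 0 := by
        unfold be
        rw [th_deriv_zero (s := -log (ff q) / k)]
        · simp
        · have : -log (ff q) / k ≤ 0 := div_nonpos_of_nonpos_of_nonneg (by linarith) hk.le
          linarith
      rw [hb, zero_mul]
      have : 0 ≤ L * C / k * (F / ff q * Z) := by positivity
      linarith
  have p2 : -(2 * L * C / k * (F / ff q * Z)) ≤
      2 * ga a k q * ((∑ i, q.2 i * dx i φ q) * MM c φ q + ‖q.2‖ ^ 2 * EE a c p V φ q) := by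
    set X := (∑ i, q.2 i * dx i φ q) / ‖q.2‖ ^ 2 * MM c φ q + EE a c p V φ q with hX
    have hXe : (∑ i, q.2 i * dx i φ q) * MM c φ q + ‖q.2‖ ^ 2 * EE a c p V φ q = ‖q.2‖ ^ 2 * X := by
      rw [hX]; field_simp
    set g := th (-log (ff q) / k) * (-deriv th (log (‖q.2‖ ^ 2) / k)) with hg
    have hga : 2 * ga a k q * (‖q.2‖ ^ 2 * X) = -(2 / k * (F / ff q) * (g * (ff q * X))) := by
      unfold ga; rw [hg, ← hF]; field_simp
    have hg0 : 0 ≤ g := mul_nonneg (th_nonneg _) (by linarith [th_deriv_nonpos (log (‖q.2‖ ^ 2) / k)])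
    have hgL : g ≤ L := by
      have a1 := th_le_one (-log (ff q) / k)
      have a2 : -deriv th (log (‖q.2‖ ^ 2) / k) ≤ L := (neg_le_abs _).trans (hL _)
      have a3 := th_deriv_nonpos (log (‖q.2‖ ^ 2) / k)
      calc g ≤ 1 * L := mul_le_mul a1 a2 (by linarith) (by norm_num)
        _ = L := one_mul L
    have hgX : g * (ff q * X) ≤ L * (C * Z) :=
      (mul_le_mul_of_nonneg_left h1 hg0).trans (mul_le_mul_of_nonneg_right hgL (by positivity))
    rw [hXe, hga, neg_le_neg_iff]
    calc _ ≤ 2 / k * (F / ff q) * (L * (C * Z)) := by gcongr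
      _ = _ := by ring
  calc _ = -(L * C / k * (F / ff q * Z)) + -(2 * L * C / k * (F / ff q * Z)) := by ring
    _ ≤ _ := add_le_add p1 p2


/-- **Theorem 1.8** (unique continuation for subconformal focusing equations
`□φ + V|φ|^{p−1}φ = 0`, `1 ≤ p < 1 + 4/(n−1)`): if the positive potential
`V ∈ C¹(D) ∩ L^∞(D)` satisfies the monotonicity condition
`t·∂_t V + r·∂_r V > [−((n−1)/2)(1 + 4/(n−1) − p) + μ]·V`, and the `C²` solution `φ`
satisfies `Dec(δ)` and the extra weighted decay on `{|uv| > 1}`, then `φ ≡ 0` on `D`. -/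
theorem uc_focusing (n : ℕ) (hn : 2 ≤ n) (δ μ p : ℝ) (hδ : 0 < δ) (hμ : 0 < μ)
    (hp1 : 1 ≤ p) (hp2 : p < 1 + 4 / ((n : ℝ) - 1))
    (V φ : Spacetime n → ℝ)
    (hV1 : ContDiffOn ℝ 1 V (Dom n))
    (hVbd : ∃ C : ℝ, ∀ q ∈ Dom n, |V q| ≤ C)
    (hVpos : ∀ q ∈ Dom n, 0 < V q)
    (hVmono : ∀ q ∈ Dom n, q.1 * dt V q + ‖q.2‖ * dr V q >
      (-(((n : ℝ) - 1) / 2) * (1 + 4 / ((n : ℝ) - 1) - p) + μ) * V q)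
    (hφ : ContDiffOn ℝ 2 φ (Dom n))
    (heq : ∀ q ∈ Dom n, box φ q + V q * |φ q| ^ (p - 1) * φ q = 0)
    (hdec : Dec δ φ)
    (hextra : ∃ C : ℝ, ∀ q ∈ Dom n, 1 < |uu q * vv q| →
      ((1 + |uu q|) * (1 + |vv q|)) ^ (((n : ℝ) - 1 + δ) / (p + 1)) *
        |uu q * vv q| ^ (1 / (p + 1)) * (V q) ^ (1 / (p + 1)) * |φ q| ≤ C) :
    ∀ q ∈ Dom n, φ q = 0 := by

  obtain ⟨a, ha0, ha1, haδ, haμ⟩ : ∃ a : ℝ, 0 < a ∧ 2 * a ≤ 1 ∧ 2 * a < δ ∧ 2 * a * (p - 1) < μ := by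
    refine ⟨min (1 / 2) (min (δ / 4) (μ / (4 * p))), by positivity, ?_, ?_, ?_⟩
    · have := min_le_left (1 / 2) (min (δ / 4) (μ / (4 * p)))
      linarith
    · have := (min_le_right (1 / 2) (min (δ / 4) (μ / (4 * p)))).trans (min_le_left _ _)
      linarith
    · have := (min_le_right (1 / 2) (min (δ / 4) (μ / (4 * p)))).trans (min_le_right _ _)
      have hp0 : 0 < p := by linarith
      rw [le_div_iff₀ (by positivity)] at this
      have h0 : 0 < min (1 / 2) (min (δ / 4) (μ / (4 * p))) := by positivity
      nlinarith
  obtain ⟨c, hc⟩ : ∃ c : ℝ, c = ((n:ℝ) - 1) / 2 + 2 * a := ⟨_, rfl⟩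
  obtain ⟨C, hC, hest⟩ := estimates hn a c p δ hδ hp1 V φ hVbd hVpos hdec hextra
  obtain ⟨L, hL0, hL⟩ := th_deriv_bdd
  have hHint := HH_int n hn (2 * a) δ (by linarith) ha1 haδ
  have hφa : ∀ q ∈ Dom n, ContDiffAt ℝ 2 φ q := fun q hq => hφ.contDiffAt ((Dom_open n).mem_nhds hq)
  have hVa : ∀ q ∈ Dom n, ContDiffAt ℝ 1 V q := fun q hq => hV1.contDiffAt ((Dom_open n).mem_nhds hq)
  have hpp : 0 < p + 1 := by linarith
  obtain ⟨G, hG⟩ : ∃ G : ℝ, G = (μ - 2 * a * (p - 1)) / (p + 1) := ⟨_, rfl⟩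
  have hGp : 0 < G := by rw [hG]; exact div_pos (by linarith) hpp
  set N : ℝ → Spacetime n → ℝ := fun k => Set.indicator (Dom n)
    (fun q => Wt a k q * (G * (V q * |φ q| ^ (p + 1)))) with hN
  have hind : ∀ k : ℝ, 0 < k → ∀ g : Spacetime n → ℝ, (∀ q ∈ Dom n, ContDiffAt ℝ 1 g q) →
      ContDiffOn ℝ 1 (Set.indicator (Dom n) (fun q => Wt a k q * g q)) (Dom n) ∧
      ∀ q, q ∉ Kc n k → Set.indicator (Dom n) (fun q => Wt a k q * g q) q = 0 := by
    intro k hk g hg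
    constructor
    · have : ContDiffOn ℝ 1 (fun q => Wt a k q * g q) (Dom n) := fun q hq =>
        ((Wt_smooth a k q hq).mul (hg q hq)).contDiffWithinAt
      exact this.congr fun q hq => Set.indicator_of_mem hq _
    · intro q hq
      by_cases hD : q ∈ Dom n
      · rw [Set.indicator_of_mem hD, Wt_zero a k hk q hD hq, zero_mul]
      · exact Set.indicator_of_notMem hD _
  have hNc : ∀ k : ℝ, 0 < k → Continuous (N k) ∧ HasCompactSupport (N k) := by
    intro k hk
    have := hind k hk (fun q => G * (V q * |φ q| ^ (p + 1)))
      (fun q hq => contDiffAt_const.mul (pow_smooth p hp1 V φ q (hφa q hq) (hVa q hq)))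
    exact cpt_ext _ (Dom n) (Kc n k) (Dom_open n) (Kc_compact n k) (Kc_sub n k) this.1 this.2
  have hNi : ∀ k : ℝ, 0 < k → Integrable (N k) := fun k hk =>
    (hNc k hk).1.integrable_of_hasCompactSupport (hNc k hk).2
  have hN0 : ∀ k : ℝ, 0 ≤ N k := by
    intro k
    apply Set.indicator_nonneg
    intro q hq
    have := Wt_nonneg a k q hq
    have := hVpos q hq
    positivity
  have hmain : ∀ k : ℝ, 0 < k → ∫ q, N k q ≤ 3 * L * C / k * ∫ q, HH n (2 * a) δ q := by
    intro k hk
    set F0 : Spacetime n → ℝ := Set.indicator (Dom n) (fun q => Wt a k q * J0 a c p V φ q) with hF0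
    set FX : Fin n → Spacetime n → ℝ := fun i =>
      Set.indicator (Dom n) (fun q => Wt a k q * JX a c p V φ i q) with hFX
    have s0 := hind k hk (J0 a c p V φ)
      (fun q hq => (J_smooth a c p hp1 V φ q hq (hφa q hq) (hVa q hq)).1)
    have sX := fun i => hind k hk (JX a c p V φ i)
      (fun q hq => (J_smooth a c p hp1 V φ q hq (hφa q hq) (hVa q hq)).2 i)
    have i0 := int_fderiv_zero F0 (Dom n) (Kc n k) (Dom_open n) (Kc_compact n k) (Kc_sub n k)
      s0.1 s0.2 (1, 0)
    have iX := fun i => int_fderiv_zero (FX i) (Dom n) (Kc n k) (Dom_open n) (Kc_compact n k)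
      (Kc_sub n k) (sX i).1 (sX i).2 (0, EuclideanSpace.single i 1)
    have hsum : Integrable (fun q => ∑ i, fderiv ℝ (FX i) q (0, EuclideanSpace.single i 1)) :=
      integrable_finsetSum _ fun i _ => (iX i).1
    have hz : ∫ q, (fderiv ℝ F0 q (1, 0) + ∑ i, fderiv ℝ (FX i) q (0, EuclideanSpace.single i 1)) = 0 := by
      rw [integral_add i0.1 hsum, i0.2, integral_finsetSum _ fun i _ => (iX i).1]
      simp [fun i => (iX i).2]
    have hpt : ∀ q, N k q - 3 * L * C / k * HH n (2 * a) δ q ≤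
        fderiv ℝ F0 q (1, 0) + ∑ i, fderiv ℝ (FX i) q (0, EuclideanSpace.single i 1) := by
      intro q
      by_cases hq : q ∈ Dom n
      · have hev : ∀ g : Spacetime n → ℝ, Set.indicator (Dom n) g =ᶠ[nhds q] g := by
          intro g
          filter_upwards [(Dom_open n).mem_nhds hq] with y hy
          exact Set.indicator_of_mem hy g
        have e0 : fderiv ℝ F0 q = fderiv ℝ (fun q => Wt a k q * J0 a c p V φ q) q := (hev _).fderiv_eq
        have eX : ∀ i, fderiv ℝ (FX i) q = fderiv ℝ (fun q => Wt a k q * JX a c p V φ i q) q :=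
          fun i => (hev _).fderiv_eq
        simp only [e0, eX]
        rw [div_identity hn a c p k hc hk hp1 V φ q hq (hφa q hq) (hVa q hq) (heq q hq)]
        have herr := err_bound a c p δ k L C hk V φ hL hC q hq (hest q hq).1 (hest q hq).2
        have hNq : N k q = Wt a k q * (G * (V q * |φ q| ^ (p + 1))) := Set.indicator_of_mem hq _
        rw [hNq]
        have hW := Wt_nonneg a k q hq
        have hfp := ff_pos hq
        have hr := norm_pos_of hq
        have hSV : fderiv ℝ V q q = q.1 * dt V q + ‖q.2‖ * dr V q := by
          rw [vec_decomp q (fderiv ℝ V q)]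
          unfold dr
          rw [mul_div_cancel₀ _ hr.ne']
          rfl
        have hmono := hVmono q hq
        rw [← hSV] at hmono
        have hGV : G * V q ≤ (fderiv ℝ V q q + (((n:ℝ) - 1) / 2 * (1 + 4 / ((n:ℝ) - 1) - p) - 2 * a * (p - 1)) * V q) / (p + 1) := by
          rw [hG, div_mul_eq_mul_div]
          apply div_le_div_of_nonneg_right _ hpp.le
          linarith
        have hfin : G * (V q * |φ q| ^ (p + 1)) ≤ a / ff q * MM c φ q ^ 2 +
            (fderiv ℝ V q q + (((n:ℝ) - 1) / 2 * (1 + 4 / ((n:ℝ) - 1) - p) - 2 * a * (p - 1)) * V q) / (p + 1)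
            * |φ q| ^ (p + 1) := by
          have t1 : 0 ≤ a / ff q * MM c φ q ^ 2 := by positivity
          have t2 := mul_le_mul_of_nonneg_right hGV (show 0 ≤ |φ q| ^ (p + 1) by positivity)
          linarith
        have := mul_le_mul_of_nonneg_left hfin hW
        linarith
      · have hqK : q ∈ (Kc n k)ᶜ := fun h => hq (Kc_sub n k h)
        have hev : ∀ g : Spacetime n → ℝ, (∀ q, q ∉ Kc n k → g q = 0) → fderiv ℝ g q = 0 := by
          intro g hg
          have : g =ᶠ[nhds q] fun _ => (0:ℝ) := by
            filter_upwards [(Kc_compact n k).isClosed.isOpen_compl.mem_nhds hqK] with y hy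
            exact hg y hy
          rw [this.fderiv_eq]; simp
        rw [hev F0 s0.2]
        simp only [hev _ (sX _).2, hFX]
        have h1 : N k q = 0 := Set.indicator_of_notMem hq _
        have h2 : HH n (2 * a) δ q = 0 := Set.indicator_of_notMem hq _
        simp [h1, h2]
    have := integral_mono ((hNi k hk).sub (hHint.const_mul _)) (i0.1.add hsum) hpt
    simp only [Pi.add_apply, Pi.sub_apply] at this
    rw [hz, integral_sub (hNi k hk) (hHint.const_mul _), integral_const_mul] at this
    linarith
  intro q0 hq0
  by_contra hne
  set k0 := 1 + |log (ff q0)| + |log (‖q0.2‖ ^ 2)| with hk0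
  have hk0p : 0 < k0 := by positivity
  have hpos : 0 < ∫ q, N k0 q := by
    apply (hNc k0 hk0p).1.integral_pos_of_hasCompactSupport_nonneg_nonzero (hNc k0 hk0p).2 (hN0 k0) (x := q0)
    have hNq : N k0 q0 = Wt a k0 q0 * (G * (V q0 * |φ q0| ^ (p + 1))) := Set.indicator_of_mem hq0 _
    rw [hNq]
    have hfp := ff_pos hq0
    have hVp := hVpos q0 hq0
    have hab : 0 < |φ q0| := abs_pos.2 hne
    have hw : Wt a k0 q0 = ff q0 ^ (2 * a) := by
      unfold Wt
      rw [th_one, th_one]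
      · ring
      · rw [div_le_one hk0p, hk0]
        linarith [le_abs_self (log (‖q0.2‖ ^ 2)), abs_nonneg (log (ff q0))]
      · rw [div_le_one hk0p, hk0]
        linarith [neg_le_abs (log (ff q0)), abs_nonneg (log (‖q0.2‖ ^ 2))]
    rw [hw]
    positivity
  set ε := ∫ q, N k0 q with hε
  set I := ∫ q, HH n (2 * a) δ q with hI
  have hle : ∀ k, k0 ≤ k → ε * k ≤ 3 * L * C * I := by
    intro k hk
    have hkp : 0 < k := by linarith
    have h1 : ε ≤ ∫ q, N k q := by
      apply integral_mono (hNi k0 hk0p) (hNi k hkp)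
      intro q
      apply Set.indicator_le_indicator'
      intro hq
      have hfp := ff_pos hq
      have hVp := hVpos q hq
      have a1 := th_nonneg (-log (ff q) / k0)
      have a2 := th_nonneg (log (‖q.2‖ ^ 2) / k0)
      have a3 := th_nonneg (-log (ff q) / k)
      have a4 := th_mono_k (s := -log (ff q)) hk0p hk
      have a5 := th_mono_k (s := log (‖q.2‖ ^ 2)) hk0p hk
      unfold Wt
      gcongr
    have h2 := h1.trans (hmain k hkp)
    rw [div_mul_eq_mul_div, le_div_iff₀ hkp] at h2
    exact h2
  have := hle (max k0 (3 * L * C * I / ε + 1)) (le_max_left _ _)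
  have h3 : ε * (3 * L * C * I / ε + 1) ≤ 3 * L * C * I :=
    (mul_le_mul_of_nonneg_left (le_max_right _ _) hpos.le).trans this
  rw [mul_add, mul_div_cancel₀ _ hpos.ne'] at h3
  linarith
end
end

section
/- Let n ≥ 2, δ > 0, and p ≥ 1 + 4/(n−1). Suppose V ∈ C¹(D) ∩ L^∞(D) satisfies V > 0 on D and t·∂_t V + r·∂_r V ≤ ((n−1)/2)·(p − 1 − 4/(n−1))·V everywhere on D. Suppose φ ∈ C²(D) satisfies the defocusing equation □φ − V·|φ|^{p−1}φ = 0 on D and satisfies the decay condition Dec(δ). Then φ = 0 everywhere on D. -/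
open Real MeasureTheory
open scoped BigOperators

noncomputable section

namespace UC

lemma int_k (c m : ℝ) (hc : 0 < c) (hm : c < m) :
    IntegrableOn (fun s : ℝ => s ^ (c - 1) * (1 + s) ^ (-m)) (Set.Ioi 0) := by
  have hmeas : Measurable (fun s : ℝ => s ^ (c - 1) * (1 + s) ^ (-m)) := by fun_prop
  rw [← Set.Ioc_union_Ioi_eq_Ioi (zero_le_one (α := ℝ))]
  apply IntegrableOn.union
  · have h1 : IntegrableOn (fun s : ℝ => s ^ (c - 1)) (Set.Ioc 0 1) := by
      have := (intervalIntegral.intervalIntegrable_rpow' (r := c - 1) (a := 0) (b := 1)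
        (by linarith))
      rwa [intervalIntegrable_iff_integrableOn_Ioc_of_le zero_le_one] at this
    refine Integrable.mono' h1 hmeas.aestronglyMeasurable ?_
    refine (ae_restrict_iff' measurableSet_Ioc).2 (Filter.Eventually.of_forall ?_)
    intro s hs
    have h0 : 0 ≤ s ^ (c - 1) := rpow_nonneg hs.1.le _
    have h2 : (1 + s) ^ (-m) ≤ 1 :=
      rpow_le_one_of_one_le_of_nonpos (by linarith [hs.1]) (by linarith)
    have h3 : 0 ≤ (1 + s) ^ (-m) := rpow_nonneg (by linarith [hs.1]) _
    rw [Real.norm_of_nonneg (mul_nonneg h0 h3)]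
    exact mul_le_of_le_one_right h0 h2
  · have h1 : IntegrableOn (fun s : ℝ => s ^ (c - 1 - m)) (Set.Ioi 1) :=
      integrableOn_Ioi_rpow_of_lt (by linarith) one_pos
    refine Integrable.mono' h1 hmeas.aestronglyMeasurable ?_
    refine (ae_restrict_iff' measurableSet_Ioi).2 (Filter.Eventually.of_forall ?_)
    intro s hs
    have hs' : (1:ℝ) < s := hs
    have hs0 : 0 < s := by linarith
    have h0 : 0 ≤ s ^ (c - 1) := rpow_nonneg hs0.le _
    have h2 : (1 + s) ^ (-m) ≤ s ^ (-m) :=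
      rpow_le_rpow_of_nonpos hs0 (by linarith) (by linarith)
    have h3 : 0 ≤ (1 + s) ^ (-m) := rpow_nonneg (by linarith) _
    rw [Real.norm_of_nonneg (mul_nonneg h0 h3), sub_eq_add_neg (c - 1) m, rpow_add hs0]
    exact mul_le_mul_of_nonneg_left h2 h0

def kk (a m : ℝ) (s : ℝ) : ℝ := (Set.Ioi (0:ℝ)).indicator (fun s => s ^ (a - 1) * (1 + s) ^ (-m)) s

lemma kk_meas (a m : ℝ) : Measurable (kk a m) := by
  unfold kk
  exact Measurable.indicator (by fun_prop) measurableSet_Ioi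

lemma kk_int (a m : ℝ) (ha : 0 < a) (hm : a < m) : Integrable (kk a m) := by
  have := int_k a m ha hm
  rw [← integrable_indicator_iff measurableSet_Ioi] at this
  exact this

lemma kk_pos (a m s : ℝ) (hs : 0 < s) : kk a m s = s ^ (a - 1) * (1 + s) ^ (-m) := by
  simp [kk, hs]

lemma kk_nonneg (a m s : ℝ) : 0 ≤ kk a m s := by
  unfold kk
  apply Set.indicator_nonneg
  intro s hs
  have : (0:ℝ) < s := hs
  positivity

lemma kk_anti (a m s s' : ℝ) (ha : a < 1) (hm : 0 < m) (hs : 0 < s) (h : s ≤ s') :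
    kk a m s' ≤ kk a m s := by
  have hs' := hs.trans_le h
  rw [kk_pos _ _ _ hs, kk_pos _ _ _ hs']
  have h1 : s' ^ (a - 1) ≤ s ^ (a - 1) := rpow_le_rpow_of_nonpos hs h (by linarith)
  have h2 : (1 + s') ^ (-m) ≤ (1 + s) ^ (-m) :=
    rpow_le_rpow_of_nonpos (by linarith) (by linarith) (by linarith)
  apply mul_le_mul h1 h2 (by positivity) (by positivity)

lemma kk_norm_int (n : ℕ) (hn : 2 ≤ n) (a m : ℝ) (ha : 0 < a) (hm : (n:ℝ) - 1 + a < m) :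
    Integrable (fun x : EuclideanSpace ℝ (Fin n) => kk a m (‖x‖ / 2)) := by
  have : Nonempty (Fin n) := ⟨⟨0, by omega⟩⟩
  have hn' : (2:ℝ) ≤ n := by exact_mod_cast hn
  have := (integrable_fun_norm_addHaar (E := EuclideanSpace ℝ (Fin n)) volume
    (f := fun y : ℝ => kk a m (y / 2))).2
  apply this
  have h1 := int_k ((n:ℝ) - 1 + a) m (by linarith) hm
  have h2 := (integrableOn_Ioi_comp_mul_left_iff
    (fun s : ℝ => s ^ ((n:ℝ) - 1 + a - 1) * (1 + s) ^ (-m)) 0 (a := (1/2:ℝ)) (by norm_num)).2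
    (by simpa using h1)
  have h3 := h2.const_mul ((2:ℝ) ^ ((n:ℝ) - 1))
  refine h3.congr ?_
  refine (ae_restrict_iff' measurableSet_Ioi).2 (Filter.Eventually.of_forall ?_)
  intro s hs
  have hs' : (0:ℝ) < s := hs
  have hs2 : 0 < s / 2 := by positivity
  simp only [finrank_euclideanSpace, Fintype.card_fin, smul_eq_mul]
  rw [kk_pos _ _ _ hs2, show (1/2:ℝ) * s = s / 2 by ring,
    show (n:ℝ) - 1 + a - 1 = ((n:ℝ) - 1) + (a - 1) by ring, rpow_add hs2,
    ← Real.rpow_natCast s (n-1), Nat.cast_sub (by omega), Nat.cast_one]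
  rw [show s ^ ((n:ℝ) - 1) = (2 * (s/2)) ^ ((n:ℝ) - 1) by congr 1; ring,
    mul_rpow (by norm_num) hs2.le]
  ring

lemma kk_shift (a m : ℝ) (hK : Integrable (kk a m)) (σ : ℝ) (hσ0 : σ ≠ 0) (hσ1 : |σ| = 1) (c : ℝ) :
    Integrable (fun t : ℝ => kk a m ((c + σ * t) / 2)) ∧
    ∫ t : ℝ, kk a m ((c + σ * t) / 2) = 2 * ∫ t : ℝ, kk a m t := by
  constructor
  · have e1 : Integrable (fun t : ℝ => kk a m (t / 2)) := hK.comp_div two_ne_zero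
    have e2 : Integrable (fun t : ℝ => kk a m ((c + t) / 2)) := e1.comp_add_left c
    exact e2.comp_mul_left' hσ0
  · rw [Measure.integral_comp_mul_left (fun t => kk a m ((c + t) / 2)) σ,
      integral_add_left_eq_self (fun t => kk a m (t / 2)) c, Measure.integral_comp_div]
    simp [abs_inv, hσ1]

lemma kk_prod_meas (n : ℕ) (a m σ : ℝ) : Measurable
    (fun q : Spacetime n => kk a m ((‖q.2‖ + σ * q.1) / 2) * kk a m (‖q.2‖ / 2)) := by
  have h1 : Measurable (fun q : Spacetime n => (‖q.2‖ + σ * q.1) / 2) := by fun_prop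
  have h2 : Measurable (fun q : Spacetime n => ‖q.2‖ / 2) := by fun_prop
  exact ((kk_meas a m).comp h1).mul ((kk_meas a m).comp h2)

lemma kk_prod_int (n : ℕ) (hn : 2 ≤ n) (a m : ℝ) (ha : 0 < a) (hm : (n:ℝ) - 1 + a < m)
    (σ : ℝ) (hσ : σ = 1 ∨ σ = -1) :
    Integrable (fun q : Spacetime n => kk a m ((‖q.2‖ + σ * q.1) / 2) * kk a m (‖q.2‖ / 2)) := by
  have hn' : (2:ℝ) ≤ n := by exact_mod_cast hn
  have hσ0 : σ ≠ 0 := by rcases hσ with h | h <;> simp [h]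
  have hσ1 : |σ| = 1 := by rcases hσ with h | h <;> simp [h]
  have hK := kk_int a m ha (by linarith)
  have h1 := fun c => (kk_shift a m hK σ hσ0 hσ1 c).1
  have h2 := fun c => (kk_shift a m hK σ hσ0 hσ1 c).2
  have hmeas := kk_prod_meas n a m σ
  have hsm : AEStronglyMeasurable
    (fun q : Spacetime n => kk a m ((‖q.2‖ + σ * q.1) / 2) * kk a m (‖q.2‖ / 2))
    ((volume : Measure ℝ).prod (volume : Measure (EuclideanSpace ℝ (Fin n)))) :=
    hmeas.aestronglyMeasurable
  have h3 : ∀ x : EuclideanSpace ℝ (Fin n),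
      ∫ t : ℝ, ‖kk a m ((‖x‖ + σ * t) / 2) * kk a m (‖x‖ / 2)‖
        = (2 * ∫ t : ℝ, kk a m t) * kk a m (‖x‖ / 2) := by
    intro x
    rw [← h2 ‖x‖, ← integral_mul_const]
    congr 1
    ext t
    rw [Real.norm_of_nonneg (mul_nonneg (kk_nonneg _ _ _) (kk_nonneg _ _ _))]
  rw [Measure.volume_eq_prod]
  refine (integrable_prod_iff' hsm).2
    ⟨Filter.Eventually.of_forall fun x => (h1 ‖x‖).mul_const (kk a m (‖x‖ / 2)), ?_⟩
  simp only [h3]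
  exact (kk_norm_int n hn a m ha hm).const_mul _

def FF {n : ℕ} (q : Spacetime n) : ℝ := ‖q.2‖ ^ 2 - q.1 ^ 2

lemma FF_pos_iff {n : ℕ} (q : Spacetime n) : 0 < FF q ↔ q ∈ Dom n := by
  unfold FF Dom
  rw [Set.mem_ofPred_eq, ← abs_of_nonneg (norm_nonneg q.2), ← sq_lt_sq, abs_norm, sub_pos]

lemma Dom_open (n : ℕ) : IsOpen (Dom n) := by
  unfold Dom
  exact isOpen_lt (by fun_prop) (by fun_prop)

/-- The dominating function. -/
def MM {n : ℕ} (a m : ℝ) (q : Spacetime n) : ℝ :=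
  FF q ^ (a - 1) * ((1 + |uu q|) * (1 + |vv q|)) ^ (-m)

lemma MM_int (n : ℕ) (hn : 2 ≤ n) (a m : ℝ) (ha : 0 < a) (ha1 : a < 1)
    (hm : (n:ℝ) - 1 + a < m) : IntegrableOn (MM a m) (Dom n) := by
  have hn' : (2:ℝ) ≤ n := by exact_mod_cast hn
  have h1 := kk_prod_int n hn a m ha hm 1 (Or.inl rfl)
  have h2 := kk_prod_int n hn a m ha hm (-1) (Or.inr rfl)
  have h3 := ((h1.add h2).const_mul ((4:ℝ) ^ (a - 1))).integrableOn (s := Dom n)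
  have hmeas : Measurable (MM (n := n) a m) := by
    unfold MM FF uu vv
    fun_prop
  refine Integrable.mono' h3 hmeas.aestronglyMeasurable ?_
  refine (ae_restrict_iff' (Dom_open n).measurableSet).2 (Filter.Eventually.of_forall ?_)
  rintro ⟨t, x⟩ hq
  have hq' : |t| < ‖x‖ := hq
  have hlt := abs_lt.1 hq'
  have hs1 : 0 < (‖x‖ + 1 * t) / 2 := by linarith
  have hs2 : 0 < (‖x‖ + (-1) * t) / 2 := by linarith
  have hM : MM a m ((t, x) : Spacetime n) =
      4 ^ (a - 1) * (kk a m ((‖x‖ + 1 * t) / 2) * kk a m ((‖x‖ + (-1) * t) / 2)) := by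
    rw [kk_pos _ _ _ hs1, kk_pos _ _ _ hs2]
    unfold MM FF uu vv
    simp only
    rw [abs_of_neg (show (t - ‖x‖) / 2 < 0 by linarith),
      abs_of_pos (show 0 < (t + ‖x‖) / 2 by linarith)]
    rw [show -((t - ‖x‖) / 2) = (‖x‖ + (-1) * t) / 2 by ring,
      show (t + ‖x‖) / 2 = (‖x‖ + 1 * t) / 2 by ring,
      show ‖x‖ ^ 2 - t ^ 2 = 4 * ((‖x‖ + 1 * t) / 2 * ((‖x‖ + (-1) * t) / 2)) by ring,
      mul_rpow (by norm_num) (by positivity), mul_rpow hs1.le hs2.le,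
      mul_rpow (by linarith) (by linarith)]
    ring
  have hn1 := kk_nonneg a m ((‖x‖ + 1 * t) / 2)
  have hn2 := kk_nonneg a m ((‖x‖ + (-1) * t) / 2)
  have hr : 0 < ‖x‖ / 2 := by linarith
  have hn3 := kk_nonneg a m (‖x‖ / 2)
  rw [hM, Real.norm_of_nonneg (by positivity)]
  simp only [Pi.add_apply]
  apply mul_le_mul_of_nonneg_left _ (by positivity)
  rcases le_total 0 t with ht | ht
  · have := kk_anti a m (‖x‖ / 2) ((‖x‖ + 1 * t) / 2) ha1 (by linarith) hr (by linarith)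
    nlinarith
  · have := kk_anti a m (‖x‖ / 2) ((‖x‖ + (-1) * t) / 2) ha1 (by linarith) hr (by linarith)
    nlinarith

/-- The cutoff function. -/
lemma exists_cutoff : ∃ h : ℝ → ℝ, ContDiff ℝ 1 h ∧ (∀ x, 0 ≤ h x) ∧ (∀ x, h x ≤ 1) ∧
    (∀ x, 2 ≤ |x| → h x = 0) ∧
    (∀ x, |x| ≤ 1 → h x = 1) ∧ (∀ x, x ≤ 0 → 0 ≤ deriv h x) ∧ (∀ x, 0 ≤ x → deriv h x ≤ 0) ∧
    ∃ C, 0 ≤ C ∧ ∀ x, |deriv h x| ≤ C := by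
  have hc : ContDiff ℝ 1 (fun x : ℝ => smoothTransition (2 - x ^ 2)) :=
    (smoothTransition.contDiff (n := 1)).comp (by fun_prop)
  have hd : ∀ x : ℝ, deriv (fun x : ℝ => smoothTransition (2 - x ^ 2)) x
      = deriv smoothTransition (2 - x ^ 2) * (- (2 * x)) := by
    intro x
    have h1 : HasDerivAt (fun x : ℝ => 2 - x ^ 2) (-(2 * x)) x := by
      simpa using (hasDerivAt_pow 2 x).const_sub 2
    have h2 : DifferentiableAt ℝ smoothTransition (2 - x ^ 2) :=
      (smoothTransition.contDiff (n := 1)).differentiable one_ne_zero _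
    exact (h2.hasDerivAt.comp x h1).deriv
  have hz : ∀ x : ℝ, 2 ≤ |x| → smoothTransition (2 - x ^ 2) = 0 := by
    intro x hx
    apply smoothTransition.zero_of_nonpos
    nlinarith [sq_abs x]
  have hmono : ∀ y, 0 ≤ deriv smoothTransition y := fun y => smoothTransition.monotone.deriv_nonneg
  have hcs : HasCompactSupport (fun x : ℝ => smoothTransition (2 - x ^ 2)) := by
    apply HasCompactSupport.intro (isCompact_Icc (a := (-2:ℝ)) (b := 2))
    intro x hx
    apply hz
    by_contra hlt
    push Not at hlt
    exact hx ⟨(abs_lt.1 hlt).1.le, (abs_lt.1 hlt).2.le⟩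
  obtain ⟨C, hC⟩ := (hcs.deriv).exists_bound_of_continuous (hc.continuous_deriv le_rfl)
  refine ⟨_, hc, fun x => smoothTransition.nonneg _, fun x => smoothTransition.le_one _, hz,
    ?_, ?_, ?_, C, (norm_nonneg _).trans (hC 0), hC⟩
  · intro x hx
    apply smoothTransition.one_of_one_le
    nlinarith [sq_abs x, abs_nonneg x]
  · intro x hx
    rw [hd]
    exact mul_nonneg (hmono _) (by linarith)
  · intro x hx
    rw [hd]
    nlinarith [hmono (2 - x ^ 2)]

lemma int_fderiv_zero {n : ℕ} (f : Spacetime n → ℝ) (v : Spacetime n) (hc : ContDiff ℝ 1 f)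
    (hs : HasCompactSupport f) :
    Integrable (fun q => fderiv ℝ f q v) ∧ ∫ q, fderiv ℝ f q v = 0 := by
  have h1 : Continuous (fun q => fderiv ℝ f q v) :=
    (hc.continuous_fderiv one_ne_zero).clm_apply continuous_const
  have h2 : HasCompactSupport (fun q => fderiv ℝ f q v) := hs.fderiv_apply ℝ v
  have h3 := h1.integrable_of_hasCompactSupport h2 (μ := (volume : Measure (Spacetime n)))
  have h4 := hc.continuous.integrable_of_hasCompactSupport hs
    (μ := (volume : Measure (Spacetime n)))
  refine ⟨h3, ?_⟩
  have hH : (volume : Measure (Spacetime n)).IsAddHaarMeasure := by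
    rw [Measure.volume_eq_prod]
    infer_instance
  have := integral_smul_fderiv_eq_neg_fderiv_smul_of_integrable
    (μ := (volume : Measure (Spacetime n))) (f := f) (g := fun _ : Spacetime n => (1:ℝ)) (v := v)
    (by simpa using h3) (by simp) (by simpa using h4)
    (fun x _ => hc.differentiable one_ne_zero x) (by simp)
  simp at this
  exact this


/-- The coordinate basis vectors. -/
def ev {n : ℕ} : Option (Fin n) → Spacetime n
  | none => (1, 0)
  | some i => (0, EuclideanSpace.single i 1)

/-- The coordinate functions. -/
def co {n : ℕ} : Option (Fin n) → (Spacetime n →L[ℝ] ℝ)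
  | none => ContinuousLinearMap.fst ℝ ℝ (EuclideanSpace ℝ (Fin n))
  | some i => (EuclideanSpace.proj i : EuclideanSpace ℝ (Fin n) →L[ℝ] ℝ).comp
      (ContinuousLinearMap.snd ℝ ℝ (EuclideanSpace ℝ (Fin n)))

/-- The signs of the Minkowski metric. -/
def ep {n : ℕ} : Option (Fin n) → ℝ
  | none => -1
  | some _ => 1

lemma co_ev {n : ℕ} (μ : Option (Fin n)) : co μ (ev μ) = 1 := by
  cases μ <;> simp [co, ev]

lemma sum_co_ev {n : ℕ} (q : Spacetime n) : ∑ μ, co μ q • ev μ = q := by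
  rw [Fintype.sum_option]
  refine Prod.ext ?_ ?_
  · simp [co, ev, Prod.fst_sum]
  · ext i
    simp [co, ev, Prod.snd_sum, Finset.sum_apply, Pi.single_apply]

lemma lin_expand {n : ℕ} (L : Spacetime n →L[ℝ] ℝ) (q : Spacetime n) :
    L q = ∑ μ, co μ q * L (ev μ) := by
  conv_lhs => rw [← sum_co_ev q]
  simp

/-- Minkowski gradient vector of a covector. -/
def gr {n : ℕ} (L : Spacetime n →L[ℝ] ℝ) : Spacetime n := ∑ μ, (ep μ * L (ev μ)) • ev μ

lemma lin_gr {n : ℕ} (L K : Spacetime n →L[ℝ] ℝ) :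
    K (gr L) = ∑ μ, ep μ * L (ev μ) * K (ev μ) := by
  simp [gr]

lemma FF_hasFDerivAt {n : ℕ} (q : Spacetime n) : ∃ F' : Spacetime n →L[ℝ] ℝ,
    HasFDerivAt FF F' q ∧ F' q = 2 * FF q ∧
      ∀ L : Spacetime n →L[ℝ] ℝ, F' (gr L) = 2 * L q := by
  have h1 : HasFDerivAt (fun q : Spacetime n => ‖q.2‖ ^ 2) _ q := (hasFDerivAt_snd (p := q)).norm_sq
  have h2 := (hasFDerivAt_fst (𝕜 := ℝ) (E := ℝ) (F := EuclideanSpace ℝ (Fin n)) (p := q)).pow 2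
  refine ⟨_, h1.sub h2, ?_, ?_⟩
  · simp [FF]; ring
  · intro L
    rw [lin_gr, lin_expand L, Fintype.sum_option, Fintype.sum_option, mul_add, Finset.mul_sum]
    congr 1
    · simp [ep, ev, co]; ring
    · apply Finset.sum_congr rfl
      intro i _
      simp [ep, ev, co, EuclideanSpace.inner_single_right]; ring

lemma RR_hasFDerivAt {n : ℕ} (q : Spacetime n) : ∃ F' : Spacetime n →L[ℝ] ℝ,
    HasFDerivAt (fun q : Spacetime n => ‖q.2‖ ^ 2) F' q ∧ F' q = 2 * ‖q.2‖ ^ 2 ∧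
      ∀ L : Spacetime n →L[ℝ] ℝ, F' (gr L) = 2 * ∑ i, q.2 i * L (ev (some i)) := by
  have h1 : HasFDerivAt (fun q : Spacetime n => ‖q.2‖ ^ 2) _ q := (hasFDerivAt_snd (p := q)).norm_sq
  refine ⟨_, h1, ?_, ?_⟩
  · simp
  · intro L
    rw [lin_gr, Fintype.sum_option, Finset.mul_sum]
    have : ∀ a b c : ℝ, a = 0 → b = c → a + b = c := by intros; linarith
    apply this
    · simp [ep, ev]
    · apply Finset.sum_congr rfl
      intro i _
      simp [ep, ev, EuclideanSpace.inner_single_right]; ring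

def QQ {n : ℕ} (φ : Spacetime n → ℝ) (q : Spacetime n) : ℝ :=
  ∑ μ, ep μ * (fderiv ℝ φ q (ev μ)) ^ 2

lemma QQ_gr {n : ℕ} (φ : Spacetime n → ℝ) (q : Spacetime n) :
    fderiv ℝ φ q (gr (fderiv ℝ φ q)) = QQ φ q := by
  rw [lin_gr, QQ]
  apply Finset.sum_congr rfl
  intro i _
  ring

def GG {n : ℕ} (p : ℝ) (V φ : Spacetime n → ℝ) (q : Spacetime n) : ℝ :=
  V q * |φ q| ^ (p + 1) / (p + 1)

def TT {n : ℕ} (b : ℝ) (φ : Spacetime n → ℝ) (q : Spacetime n) : ℝ := fderiv ℝ φ q q + b * φ q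

def AA {n : ℕ} (a b : ℝ) (η φ : Spacetime n → ℝ) (q : Spacetime n) : ℝ :=
  η q * (FF q ^ a * TT b φ q)

def BB {n : ℕ} (a b p : ℝ) (η V φ : Spacetime n → ℝ) (q : Spacetime n) : ℝ :=
  η q * (a * b * (FF q ^ (a - 1) * φ q ^ 2) - FF q ^ a * (QQ φ q / 2 + GG p V φ q))

/-- The current. -/
def YY {n : ℕ} (a b p : ℝ) (η V φ : Spacetime n → ℝ) (μ : Option (Fin n)) (q : Spacetime n) : ℝ :=
  AA a b η φ q * (ep μ * fderiv ℝ φ q (ev μ)) + BB a b p η V φ q * co μ q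

lemma box_eq {n : ℕ} (φ : Spacetime n → ℝ) (q : Spacetime n)
    (hd : DifferentiableAt ℝ (fderiv ℝ φ) q) :
    box φ q = ∑ μ, ep μ * fderiv ℝ (fderiv ℝ φ) q (ev μ) (ev μ) := by
  have key : ∀ v : Spacetime n, fderiv ℝ (fun q => fderiv ℝ φ q v) q v
      = fderiv ℝ (fderiv ℝ φ) q v v := by
    intro v
    have := hd.hasFDerivAt.clm_apply (hasFDerivAt_const v q)
    rw [this.fderiv]
    simp
  rw [Fintype.sum_option]
  unfold box dt dx
  simp only [ep, ev, one_mul, neg_mul]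
  congr 1
  · congr 1
    exact key _
  · apply Finset.sum_congr rfl
    intro i _
    exact key _

lemma div_gen {n : ℕ} (φ A B : Spacetime n → ℝ) (q : Spacetime n)
    (A' B' : Spacetime n →L[ℝ] ℝ)
    (hd : DifferentiableAt ℝ (fderiv ℝ φ) q) (hA : HasFDerivAt A A' q) (hB : HasFDerivAt B B' q) :
    ∑ μ, fderiv ℝ (fun q => A q * (ep μ * fderiv ℝ φ q (ev μ)) + B q * co μ q) q (ev μ)
      = A' (gr (fderiv ℝ φ q)) + A q * box φ q + B' q + (n + 1) * B q := by
  have h1 : ∀ μ : Option (Fin n),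
      fderiv ℝ (fun q => A q * (ep μ * fderiv ℝ φ q (ev μ)) + B q * co μ q) q (ev μ)
      = ep μ * fderiv ℝ φ q (ev μ) * A' (ev μ)
        + A q * (ep μ * fderiv ℝ (fderiv ℝ φ) q (ev μ) (ev μ))
        + co μ q * B' (ev μ) + B q := by
    intro μ
    have h2 := (hd.hasFDerivAt.clm_apply (hasFDerivAt_const (ev μ) q)).const_mul (ep μ)
    have h3 := (hA.mul h2).add (hB.mul (co μ).hasFDerivAt)
    have h4 := h3.fderiv
    simp only [Pi.mul_def, Pi.add_def] at h4
    rw [h4]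
    simp [co_ev]
    ring
  simp only [h1]
  rw [Finset.sum_add_distrib, Finset.sum_add_distrib, Finset.sum_add_distrib, lin_gr, box_eq φ q hd,
    lin_expand B', ← Finset.mul_sum]
  simp

lemma main_identity {n : ℕ} (a p : ℝ) (hp : 1 < p) (η V φ : Spacetime n → ℝ) (q : Spacetime n)
    (hq : q ∈ Dom n) (η' : Spacetime n →L[ℝ] ℝ) (hη : HasFDerivAt η η' q)
    (hV : DifferentiableAt ℝ V q) (hφ : ContDiffAt ℝ 2 φ q)
    (heq : box φ q - V q * |φ q| ^ (p - 1) * φ q = 0) (b : ℝ) (hb : b = a + ((n:ℝ) - 1) / 2) :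
    ∑ μ, fderiv ℝ (YY a b p η V φ μ) q (ev μ) =
      η q * (2 * a * FF q ^ (a - 1) * TT b φ q ^ 2
        + FF q ^ a * (|φ q| ^ (p + 1) / (p + 1)) *
          (- fderiv ℝ V q q + (a * (p - 1) + ((n:ℝ) - 1) / 2 * (p - 1) - 2) * V q))
      + (η' (gr (fderiv ℝ φ q)) * (FF q ^ a * TT b φ q)
        + η' q * (a * b * (FF q ^ (a - 1) * φ q ^ 2) - FF q ^ a * (QQ φ q / 2 + GG p V φ q))) := by
  have hF : 0 < FF q := (FF_pos_iff q).2 hq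
  have hd1 : DifferentiableAt ℝ φ q := hφ.differentiableAt two_ne_zero
  have hd2 : DifferentiableAt ℝ (fderiv ℝ φ) q :=
    (hφ.fderiv_right (m := 1) (by norm_num)).differentiableAt one_ne_zero
  have hsymm : ∀ v w, fderiv ℝ (fderiv ℝ φ) q v w = fderiv ℝ (fderiv ℝ φ) q w v :=
    fun v w => (hφ.isSymmSndFDerivAt (by simp)) v w
  obtain ⟨F', hF', hF'q, hF'gr⟩ := FF_hasFDerivAt q
  have hFa := hF'.rpow_const (p := a) (Or.inl hF.ne')
  have hFa1 := hF'.rpow_const (p := a - 1) (Or.inl hF.ne')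
  have hT : HasFDerivAt (TT b φ) _ q :=
    (hd2.hasFDerivAt.clm_apply (hasFDerivAt_id q)).add (hd1.hasFDerivAt.const_mul b)
  have hA : HasFDerivAt (AA a b η φ) _ q := hη.mul (hFa.mul hT)
  have hQ : HasFDerivAt (QQ φ) _ q := HasFDerivAt.fun_sum (u := Finset.univ) (fun μ _ =>
    (((hd2.hasFDerivAt.clm_apply (hasFDerivAt_const (ev μ) q)).pow 2).const_mul (ep μ)))
  have hP : HasFDerivAt (fun q => |φ q| ^ (p + 1)) _ q :=
    (hasDerivAt_abs_rpow (φ q) (p := p + 1) (by linarith)).comp_hasFDerivAt q hd1.hasFDerivAt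
  have hG : HasFDerivAt (GG p V φ) _ q := (hV.hasFDerivAt.mul hP).mul_const ((p + 1)⁻¹)
  have hB : HasFDerivAt (BB a b p η V φ) _ q :=
    hη.mul (((hFa1.mul (hd1.hasFDerivAt.pow 2)).const_mul (a * b)).sub
      (hFa.mul ((hQ.mul_const (2⁻¹ : ℝ)).add hG)))
  have hdiv := div_gen φ _ _ q _ _ hd2 hA hB
  change ∑ μ, fderiv ℝ (fun q => AA a b η φ q * (ep μ * fderiv ℝ φ q (ev μ))
    + BB a b p η V φ q * co μ q) q (ev μ) = _
  rw [hdiv]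
  have hbox : box φ q = V q * |φ q| ^ (p - 1) * φ q := by linarith
  have hsum : ∑ μ, ep μ * (2 * fderiv ℝ φ q (ev μ) * fderiv ℝ (fderiv ℝ φ) q q (ev μ))
      = 2 * fderiv ℝ (fderiv ℝ φ) q (gr (fderiv ℝ φ q)) q := by
    rw [hsymm, lin_gr, Finset.mul_sum]
    apply Finset.sum_congr rfl
    intro i _
    ring
  have hQgr := QQ_gr φ q
  have hFaa : FF q ^ a = FF q * FF q ^ (a - 1) := by
    rw [rpow_sub_one hF.ne']
    field_simp
  have hFaa1 : FF q ^ (a - 1 - 1) = FF q ^ (a - 1) / FF q := rpow_sub_one hF.ne' _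
  have hpow : |φ q| ^ (p + 1) = |φ q| ^ (p - 1) * φ q ^ 2 := by
    rw [← sq_abs, ← Real.rpow_natCast |φ q| 2, ← rpow_add' (abs_nonneg _) (by norm_num; linarith)]
    congr 1
    norm_num
    ring
  rw [Fintype.sum_option, ← eq_sub_iff_add_eq'] at hsum
  simp
  rw [hsum, hQgr, hF'gr, hF'q, hFaa1, hbox]
  have hp1 : p + 1 ≠ 0 := by linarith
  have e2 : p + 1 - 2 = p - 1 := by ring
  simp only [AA, BB, TT, GG, hFaa, hpow, e2]
  generalize FF q ^ (a - 1) = k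
  generalize |φ q| ^ (p - 1) = z
  generalize FF q = f at hF ⊢
  subst hb
  field_simp
  ring


lemma angSq_nonneg {n : ℕ} (φ : Spacetime n → ℝ) (q : Spacetime n) (hq : 0 < ‖q.2‖) :
    0 ≤ angSq φ q := by
  unfold angSq dr
  have h := Finset.sum_mul_sq_le_sq_mul_sq Finset.univ (fun i => q.2 i) (fun i => dx i φ q)
  have h2 : ‖q.2‖ ^ 2 = ∑ i, q.2 i ^ 2 := by
    rw [EuclideanSpace.norm_sq_eq]
    simp
  rw [← h2] at h
  rw [div_pow, sub_nonneg, div_le_iff₀ (by positivity)]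
  linarith

/-- The decay weight. -/
def WW {n : ℕ} (m : ℝ) (q : Spacetime n) : ℝ := ((1 + |uu q|) * (1 + |vv q|)) ^ (-(m / 2))

lemma WW_base {n : ℕ} (q : Spacetime n) : 1 ≤ (1 + |uu q|) * (1 + |vv q|) := by
  nlinarith [abs_nonneg (uu q), abs_nonneg (vv q), mul_nonneg (abs_nonneg (uu q)) (abs_nonneg (vv q))]

lemma WW_nonneg {n : ℕ} (m : ℝ) (q : Spacetime n) : 0 ≤ WW m q := by
  unfold WW
  positivity

lemma WW_le_one {n : ℕ} (m : ℝ) (hm : 0 ≤ m) (q : Spacetime n) : WW m q ≤ 1 :=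
  rpow_le_one_of_one_le_of_nonpos (WW_base q) (by linarith)

lemma MM_eq {n : ℕ} (a m : ℝ) (q : Spacetime n) : MM a m q = FF q ^ (a - 1) * WW m q ^ 2 := by
  unfold MM WW
  have h0 : 0 < (1 + |uu q|) * (1 + |vv q|) := by linarith [WW_base q]
  rw [← Real.rpow_natCast _ 2, ← rpow_mul h0.le]
  congr 2
  norm_num

lemma le_of_weight {n : ℕ} (m : ℝ) (q : Spacetime n) (X C : ℝ)
    (h : ((1 + |uu q|) * (1 + |vv q|)) ^ (m / 2) * X ≤ C) : X ≤ C * WW m q := by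
  have h0 : 0 < (1 + |uu q|) * (1 + |vv q|) := by linarith [WW_base q]
  unfold WW
  rw [rpow_neg h0.le, ← div_eq_mul_inv, le_div_iff₀ (by positivity)]
  linarith

lemma dec_unpack {n : ℕ} (δ : ℝ) (φ : Spacetime n → ℝ) (hdec : Dec δ φ) :
    ∃ C, 0 ≤ C ∧ ∀ q ∈ Dom n,
      |uu q * du φ q| + |vv q * dv φ q| ≤ C * WW ((n:ℝ) - 1 + δ) q ∧
      (|uu q * vv q| < 1 → |uu q * vv q| * angSq φ q ≤ (C * WW ((n:ℝ) - 1 + δ) q) ^ 2) ∧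
      |φ q| ≤ C * WW ((n:ℝ) - 1 + δ) q := by
  obtain ⟨⟨C1, h1⟩, ⟨C2, h2⟩, ⟨C3, h3⟩⟩ := hdec
  refine ⟨|C1| + |C2| + |C3|, by positivity, fun q hq => ?_⟩
  have hW := WW_nonneg ((n:ℝ) - 1 + δ) q
  have hr : 0 < ‖q.2‖ := (abs_nonneg q.1).trans_lt hq
  have k1 : C1 ≤ |C1| + |C2| + |C3| := by
    linarith [le_abs_self C1, abs_nonneg C2, abs_nonneg C3]
  have k2 : C2 ≤ |C1| + |C2| + |C3| := by
    linarith [le_abs_self C2, abs_nonneg C1, abs_nonneg C3]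
  have k3 : C3 ≤ |C1| + |C2| + |C3| := by
    linarith [le_abs_self C3, abs_nonneg C2, abs_nonneg C1]
  refine ⟨?_, ?_, ?_⟩
  · exact (le_of_weight _ q _ _ (h1 q hq)).trans (mul_le_mul_of_nonneg_right k1 hW)
  · intro huv
    have := h2 q hq huv
    rw [mul_assoc] at this
    have h4 := (le_of_weight _ q _ _ this).trans (mul_le_mul_of_nonneg_right k2 hW)
    have h5 : |uu q * vv q| * angSq φ q =
        (|uu q * vv q| ^ ((1:ℝ) / 2) * √(angSq φ q)) ^ 2 := by
      rw [mul_pow, sq_sqrt (angSq_nonneg φ q hr), ← Real.sqrt_eq_rpow, sq_sqrt (abs_nonneg _)]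
    rw [h5]
    exact pow_le_pow_left₀ (by positivity) h4 2
  · exact (le_of_weight _ q _ _ (h3 q hq)).trans (mul_le_mul_of_nonneg_right k3 hW)

lemma S_eq {n : ℕ} (φ : Spacetime n → ℝ) (q : Spacetime n) (hr : 0 < ‖q.2‖) :
    fderiv ℝ φ q q = q.1 * dt φ q + ‖q.2‖ * dr φ q := by
  rw [lin_expand, Fintype.sum_option]
  congr 1
  unfold dr
  rw [mul_div_cancel₀ _ hr.ne']
  rfl

lemma S_eq' {n : ℕ} (φ : Spacetime n → ℝ) (q : Spacetime n) (hr : 0 < ‖q.2‖) :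
    fderiv ℝ φ q q = uu q * du φ q + vv q * dv φ q := by
  rw [S_eq φ q hr]
  unfold uu vv du dv
  ring

lemma Q_eq {n : ℕ} (φ : Spacetime n → ℝ) (q : Spacetime n) :
    QQ φ q = - (du φ q * dv φ q) + angSq φ q := by
  unfold QQ
  rw [Fintype.sum_option]
  have h1 : ∑ i : Fin n, ep (some i) * fderiv ℝ φ q (ev (some i)) ^ 2 = ∑ i, dx i φ q ^ 2 := by
    apply Finset.sum_congr rfl
    intro i _
    simp [ep, ev, dx]
  have h2 : ep (none : Option (Fin n)) * fderiv ℝ φ q (ev (none : Option (Fin n))) ^ 2 = - dt φ q ^ 2 := by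
    simp [ep, ev, dt]
  rw [h1, h2]
  unfold angSq du dv
  ring

lemma FF_eq {n : ℕ} (q : Spacetime n) : FF q = - 4 * (uu q * vv q) := by
  unfold FF uu vv
  ring

/-- Scalar part of the estimate. -/
lemma scalar_bound (a b C CG k F S T U Z ang g f W x1 x2 D2 : ℝ) (ha : 0 ≤ a) (hb : 0 ≤ b)
    (hC : 0 ≤ C) (hCG : 0 ≤ CG)
    (hk : 0 ≤ k) (hF : 0 < F) (hS : S = U + Z) (hT : T = S + b * f)
    (h1 : |U| + |Z| ≤ C * W) (h3 : |f| ≤ C * W) (hang : 0 ≤ ang) (hg : 0 ≤ g)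
    (h2 : F ≤ 1 → F * ang ≤ 4 * (C * W) ^ 2) (h4 : F ≤ 1 → F * g ≤ CG * W ^ 2)
    (hx1 : F ≤ 1 → 0 ≤ x1) (hx1' : 1 ≤ F → x1 ≤ 0) (hD : |D2| ≤ 2 * (C * W)) :
    -((100 * (1 + a) * (1 + b) * C ^ 2 + 2 * CG) * (|x1| + |x2|) * (k * W ^ 2)) ≤
      x1 * k * (2 * S * T + 2 * a * b * f ^ 2 - 4 * (U * Z) - F * ang - 2 * (F * g))
      + x2 * k * ((2 * D2 - 2 * S) * T) := by
  set c := C * W with hc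
  have hc0 : 0 ≤ c := (abs_nonneg f).trans h3
  have hSb : |S| ≤ c := by rw [hS]; exact (abs_add_le _ _).trans h1
  have hTb : |T| ≤ (1 + b) * c := by
    rw [hT]
    calc |S + b * f| ≤ |S| + |b * f| := abs_add_le _ _
      _ = |S| + b * |f| := by rw [abs_mul, abs_of_nonneg hb]
      _ ≤ (1 + b) * c := by nlinarith
  have hST : |S * T| ≤ (1 + b) * c ^ 2 := by
    rw [abs_mul]
    calc |S| * |T| ≤ c * ((1 + b) * c) := mul_le_mul hSb hTb (abs_nonneg _) hc0
      _ = _ := by ring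
  have hDT : |D2 * T| ≤ 2 * (1 + b) * c ^ 2 := by
    rw [abs_mul]
    calc |D2| * |T| ≤ (2 * c) * ((1 + b) * c) := mul_le_mul hD hTb (abs_nonneg _) (by linarith)
      _ = _ := by ring
  have hUZ : |U * Z| ≤ c ^ 2 := by
    rw [abs_mul]
    nlinarith [abs_nonneg U, abs_nonneg Z]
  have hff : f ^ 2 ≤ c ^ 2 := by
    rw [← sq_abs]
    exact pow_le_pow_left₀ (abs_nonneg _) h3 2
  have hab : 0 ≤ a * b := mul_nonneg ha hb
  have hbc : 0 ≤ b * c ^ 2 := by positivity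
  have hac : 0 ≤ a * c ^ 2 := by positivity
  have habc : 0 ≤ a * b * c ^ 2 := by positivity
  have hcc : 0 ≤ c ^ 2 := by positivity
  have habf : a * b * f ^ 2 ≤ a * b * c ^ 2 := mul_le_mul_of_nonneg_left hff hab
  have habf0 : 0 ≤ a * b * f ^ 2 := by positivity
  have hCW : 0 ≤ CG * W ^ 2 := by positivity
  obtain ⟨s1, s2⟩ := abs_le.1 hST
  obtain ⟨d1, d2⟩ := abs_le.1 hDT
  obtain ⟨u1, u2⟩ := abs_le.1 hUZ
  set M := 100 * (1 + a) * (1 + b) * c ^ 2 + 2 * (CG * W ^ 2) with hM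
  have hMe : M = 100 * (c ^ 2 + a * c ^ 2 + b * c ^ 2 + a * b * c ^ 2) + 2 * (CG * W ^ 2) := by
    rw [hM]; ring
  have hp1 : -(|x1| * M) ≤
      x1 * (2 * S * T + 2 * a * b * f ^ 2 - 4 * (U * Z) - F * ang - 2 * (F * g)) := by
    rcases le_total F 1 with hF1 | hF1
    · have hx := hx1 hF1
      have := h2 hF1
      have := h4 hF1
      rw [abs_of_nonneg hx]
      have : -M ≤ 2 * S * T + 2 * a * b * f ^ 2 - 4 * (U * Z) - F * ang - 2 * (F * g) := by
        rw [hMe]; linarith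
      have h9 := mul_le_mul_of_nonneg_left this hx
      linarith
    · have hx := hx1' hF1
      rw [abs_of_nonpos hx]
      have e1 : 0 ≤ F * ang := by positivity
      have e2 : 0 ≤ F * g := by positivity
      have : 2 * S * T + 2 * a * b * f ^ 2 - 4 * (U * Z) - F * ang - 2 * (F * g) ≤ M := by
        rw [hMe]; linarith
      have h9 := mul_le_mul_of_nonpos_left this hx
      linarith
  have hp2 : -(|x2| * M) ≤ x2 * ((2 * D2 - 2 * S) * T) := by
    have h5 : |(2 * D2 - 2 * S) * T| ≤ M := by
      rw [abs_le, hMe]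
      constructor <;> linarith
    have h6 : |x2 * ((2 * D2 - 2 * S) * T)| ≤ |x2| * M := by
      rw [abs_mul]
      exact mul_le_mul_of_nonneg_left h5 (abs_nonneg _)
    exact (abs_le.1 h6).1
  have h7 := mul_le_mul_of_nonneg_left (add_le_add hp1 hp2) hk
  have e : -((100 * (1 + a) * (1 + b) * C ^ 2 + 2 * CG) * (|x1| + |x2|) * (k * W ^ 2))
      = k * (-(|x1| * M) + -(|x2| * M)) := by
    rw [hM, hc]; ring
  rw [e]
  refine h7.trans (le_of_eq ?_)
  ring

lemma flux_bound {n : ℕ} (hn : 2 ≤ n) (δ a b p : ℝ) (hδ : 0 < δ) (ha : 0 < a) (hb : 0 ≤ b)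
    (hp : 1 < p) (V φ : Spacetime n → ℝ)
    (hVbd : ∃ C : ℝ, ∀ q ∈ Dom n, |V q| ≤ C) (hVpos : ∀ q ∈ Dom n, 0 < V q) (hdec : Dec δ φ) :
    ∃ K, 0 ≤ K ∧ ∀ q ∈ Dom n, ∀ x1 x2 : ℝ, (FF q ≤ 1 → 0 ≤ x1) → (1 ≤ FF q → x1 ≤ 0) →
      -(K * (|x1| + |x2|) * MM a ((n:ℝ) - 1 + δ) q) ≤
      (x1 * (2 * fderiv ℝ φ q q) / FF q + x2 * (2 * (∑ i, q.2 i * fderiv ℝ φ q (ev (some i)))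
          / ‖q.2‖ ^ 2 - 2 * fderiv ℝ φ q q / FF q)) * (FF q ^ a * TT b φ q)
        + 2 * x1 * (a * b * (FF q ^ (a - 1) * φ q ^ 2) - FF q ^ a * (QQ φ q / 2 + GG p V φ q)) := by
  obtain ⟨C, hC, hCd⟩ := dec_unpack δ φ hdec
  obtain ⟨CV, hCV⟩ := hVbd
  have hn' : (2:ℝ) ≤ n := by exact_mod_cast hn
  refine ⟨100 * (1 + a) * (1 + b) * C ^ 2 + 2 * (|CV| * (C ^ (p - 1) * C ^ 2)), by positivity, ?_⟩
  intro q hq x1 x2 hx1 hx1'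
  obtain ⟨h1, h2, h3⟩ := hCd q hq
  have hr : 0 < ‖q.2‖ := (abs_nonneg q.1).trans_lt hq
  have hF : 0 < FF q := (FF_pos_iff q).2 hq
  have hW := WW_nonneg ((n:ℝ) - 1 + δ) q
  have hW1 := WW_le_one ((n:ℝ) - 1 + δ) (by linarith) q
  have hlt := abs_lt.1 (show |q.1| < ‖q.2‖ from hq)
  have huv : |uu q * vv q| = FF q / 4 := by
    have : uu q * vv q = - (FF q / 4) := by rw [FF_eq]; ring
    rw [this, abs_neg, abs_of_pos (by positivity)]
  have hFaa : FF q ^ a = FF q * FF q ^ (a - 1) := by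
    rw [rpow_sub_one hF.ne']
    field_simp
  have hg : 0 ≤ GG p V φ q := by
    unfold GG
    have := (hVpos q hq).le
    have : 0 < p + 1 := by linarith
    positivity
  have hDr : ∑ i, q.2 i * fderiv ℝ φ q (ev (some i)) = ‖q.2‖ * dr φ q := by
    unfold dr
    rw [mul_div_cancel₀ _ hr.ne']
    rfl
  have key := scalar_bound a b C (|CV| * (C ^ (p - 1) * C ^ 2)) (FF q ^ (a - 1)) (FF q)
    (fderiv ℝ φ q q) (TT b φ q) (uu q * du φ q) (vv q * dv φ q) (angSq φ q) (GG p V φ q) (φ q)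
    (WW ((n:ℝ) - 1 + δ) q) x1 x2 (FF q * dr φ q / ‖q.2‖) ha.le hb hC (by positivity)
    (by positivity) hF (S_eq' φ q hr) rfl h1 h3 (angSq_nonneg φ q hr) hg ?_ ?_ hx1 hx1' ?_
  · rw [MM_eq]
    refine key.trans (le_of_eq ?_)
    have hQ : FF q * QQ φ q = 4 * ((uu q * du φ q) * (vv q * dv φ q)) + FF q * angSq φ q := by
      rw [Q_eq, FF_eq]; ring
    rw [hDr, hFaa, show QQ φ q = (4 * ((uu q * du φ q) * (vv q * dv φ q)) + FF q * angSq φ q) / FF q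
      by rw [← hQ]; field_simp]
    field_simp
    ring
  · intro hF1
    have := h2 (by rw [huv]; linarith)
    rw [huv] at this
    linarith
  · intro hF1
    have hφ1 : |φ q| ≤ C := h3.trans (mul_le_of_le_one_right hC hW1)
    have e1 : |φ q| ^ (p + 1) = |φ q| ^ (p - 1) * |φ q| ^ 2 := by
      rw [← Real.rpow_natCast |φ q| 2, ← rpow_add' (abs_nonneg _) (by norm_num; linarith)]
      congr 1
      norm_num
      ring
    have e2 : |φ q| ^ (p - 1) ≤ C ^ (p - 1) :=
      rpow_le_rpow (abs_nonneg _) hφ1 (by linarith)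
    have e3 : |φ q| ^ 2 ≤ (C * WW ((n:ℝ) - 1 + δ) q) ^ 2 := pow_le_pow_left₀ (abs_nonneg _) h3 2
    have e4 : V q ≤ |CV| := (le_abs_self _).trans ((hCV q hq).trans (le_abs_self _))
    have e5 : |φ q| ^ (p + 1) ≤ C ^ (p - 1) * (C * WW ((n:ℝ) - 1 + δ) q) ^ 2 := by
      rw [e1]
      exact mul_le_mul e2 e3 (by positivity) (by positivity)
    have e6 : V q * |φ q| ^ (p + 1) ≤ |CV| * (C ^ (p - 1) * (C * WW ((n:ℝ) - 1 + δ) q) ^ 2) :=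
      mul_le_mul e4 e5 (by positivity) (abs_nonneg _)
    have e7 : GG p V φ q ≤ V q * |φ q| ^ (p + 1) := by
      unfold GG
      have := (hVpos q hq).le
      apply div_le_self (by positivity) (by linarith)
    calc FF q * GG p V φ q ≤ GG p V φ q := mul_le_of_le_one_left hg hF1
      _ ≤ _ := e7.trans e6
      _ = _ := by ring
  · have e1 : FF q * dr φ q / ‖q.2‖ =
        2 * ((vv q / ‖q.2‖) * (uu q * du φ q) - (uu q / ‖q.2‖) * (vv q * dv φ q)) := by
      rw [FF_eq]
      unfold du dv
      field_simp
      ring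
    have e2 : |vv q / ‖q.2‖| ≤ 1 := by
      rw [abs_div, abs_norm, div_le_one hr, abs_le]
      unfold vv
      constructor <;> linarith
    have e3 : |uu q / ‖q.2‖| ≤ 1 := by
      rw [abs_div, abs_norm, div_le_one hr, abs_le]
      unfold uu
      constructor <;> linarith
    rw [e1, abs_mul, abs_two]
    apply mul_le_mul_of_nonneg_left _ (by norm_num)
    refine (abs_sub _ _).trans ?_
    rw [abs_mul (vv q / _), abs_mul (uu q / _)]
    have := mul_le_of_le_one_left (abs_nonneg (uu q * du φ q)) e2
    have := mul_le_of_le_one_left (abs_nonneg (vv q * dv φ q)) e3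
    linarith


/-- The spacetime cutoff. -/
def eta {n : ℕ} (h : ℝ → ℝ) (N : ℝ) (q : Spacetime n) : ℝ :=
  h (Real.log (FF q) / N) * h ((Real.log (‖q.2‖ ^ 2) - Real.log (FF q)) / N)

lemma eta_hasFDerivAt {n : ℕ} (h : ℝ → ℝ) (hh : ContDiff ℝ 1 h) (N : ℝ) (q : Spacetime n)
    (hq : q ∈ Dom n) (x1 x2 : ℝ)
    (hx1 : x1 = deriv h (Real.log (FF q) / N) / N *
      h ((Real.log (‖q.2‖ ^ 2) - Real.log (FF q)) / N))
    (hx2 : x2 = h (Real.log (FF q) / N) *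
      (deriv h ((Real.log (‖q.2‖ ^ 2) - Real.log (FF q)) / N) / N)) :
    ∃ η' : Spacetime n →L[ℝ] ℝ, HasFDerivAt (eta h N) η' q ∧ η' q = 2 * x1 ∧
      ∀ L : Spacetime n →L[ℝ] ℝ, η' (gr L) = x1 * (2 * L q) / FF q +
        x2 * (2 * (∑ i, q.2 i * L (ev (some i))) / ‖q.2‖ ^ 2 - 2 * L q / FF q) := by
  have hF : 0 < FF q := (FF_pos_iff q).2 hq
  have hr : 0 < ‖q.2‖ := (abs_nonneg q.1).trans_lt hq
  have hR : 0 < ‖q.2‖ ^ 2 := by positivity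
  obtain ⟨F', hF', hF'q, hF'gr⟩ := FF_hasFDerivAt q
  obtain ⟨R', hR', hR'q, hR'gr⟩ := RR_hasFDerivAt q
  have hd : ∀ y, HasDerivAt h (deriv h y) y := fun y =>
    (hh.differentiable one_ne_zero y).hasDerivAt
  have l1 := hF'.log hF.ne'
  have l2 := hR'.log hR.ne'
  have e1 := (hd (Real.log (FF q) / N)).comp_hasFDerivAt q (l1.mul_const N⁻¹)
  have e2 := (hd ((Real.log (‖q.2‖ ^ 2) - Real.log (FF q)) / N)).comp_hasFDerivAt q
    ((l2.sub l1).mul_const N⁻¹)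
  have e3 : HasFDerivAt (eta h N) _ q := e1.mul e2
  refine ⟨_, e3, ?_, ?_⟩
  · rw [hx1]
    simp [hF'q, hR'q]
    field_simp
    ring
  · intro L
    rw [hx1, hx2]
    simp [hF'gr, hR'gr, ← div_eq_mul_inv]
    ring

lemma contDiffAt_YY {n : ℕ} (h : ℝ → ℝ) (hh : ContDiff ℝ 1 h) (N a b p : ℝ) (hp : 1 < p)
    (V φ : Spacetime n → ℝ) (q : Spacetime n) (hq : q ∈ Dom n) (hV : ContDiffAt ℝ 1 V q)
    (hφ : ContDiffAt ℝ 2 φ q) (μ : Option (Fin n)) :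
    ContDiffAt ℝ 1 (YY a b p (eta h N) V φ μ) q := by
  have hF : 0 < FF q := (FF_pos_iff q).2 hq
  have hr : 0 < ‖q.2‖ := (abs_nonneg q.1).trans_lt hq
  have hR : 0 < ‖q.2‖ ^ 2 := by positivity
  have cR : ContDiffAt ℝ 1 (fun q : Spacetime n => ‖q.2‖ ^ 2) q := contDiffAt_snd.norm_sq ℝ
  have cF : ContDiffAt ℝ 1 (FF (n := n)) q := cR.sub (contDiffAt_fst.pow 2)
  have cl : ContDiffAt ℝ 1 (fun q : Spacetime n => Real.log (FF q)) q := cF.log hF.ne'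
  have cl2 : ContDiffAt ℝ 1 (fun q : Spacetime n => Real.log (‖q.2‖ ^ 2)) q := cR.log hR.ne'
  have cη : ContDiffAt ℝ 1 (eta (n := n) h N) q :=
    (hh.contDiffAt.comp q (cl.div_const N)).mul (hh.contDiffAt.comp q ((cl2.sub cl).div_const N))
  have cFa : ∀ c : ℝ, ContDiffAt ℝ 1 (fun q : Spacetime n => FF q ^ c) q := fun c =>
    cF.rpow_const_of_ne hF.ne'
  have cφ : ContDiffAt ℝ 1 φ q := hφ.of_le (by norm_num)
  have cd : ContDiffAt ℝ 1 (fderiv ℝ φ) q := hφ.fderiv_right (by norm_num)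
  have cdv : ∀ v, ContDiffAt ℝ 1 (fun q => fderiv ℝ φ q v) q := fun v =>
    cd.clm_apply contDiffAt_const
  have cT : ContDiffAt ℝ 1 (TT b φ) q := (cd.clm_apply contDiffAt_id).add (contDiffAt_const.mul cφ)
  have cA : ContDiffAt ℝ 1 (AA a b (eta h N) φ) q := cη.mul ((cFa a).mul cT)
  have cQ : ContDiffAt ℝ 1 (QQ φ) q := ContDiffAt.sum (fun μ _ =>
    contDiffAt_const.mul ((cdv (ev μ)).pow 2))
  have cP : ContDiffAt ℝ 1 (fun q => |φ q| ^ (p + 1)) q :=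
    ((contDiff_norm_rpow (E := ℝ) (p := p + 1) (by linarith)).contDiffAt).comp q cφ
  have cG : ContDiffAt ℝ 1 (GG p V φ) q := (hV.mul cP).div_const _
  have cB : ContDiffAt ℝ 1 (BB a b p (eta h N) V φ) q :=
    cη.mul ((contDiffAt_const.mul ((cFa (a - 1)).mul (cφ.pow 2))).sub
      ((cFa a).mul ((cQ.div_const 2).add cG)))
  exact (cA.mul (contDiffAt_const.mul (cdv _))).add (cB.mul (co μ).contDiff.contDiffAt)

def KK (n : ℕ) (N : ℝ) : Set (Spacetime n) :=
  {q | Real.exp (-(2 * N)) ≤ FF q ∧ ‖q.2‖ ≤ Real.exp (2 * N)}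

lemma KK_sub (n : ℕ) (N : ℝ) : KK n N ⊆ Dom n := fun q hq =>
  (FF_pos_iff q).1 ((Real.exp_pos _).trans_le hq.1)

lemma KK_closed (n : ℕ) (N : ℝ) : IsClosed (KK n N) := by
  have hc : Continuous (FF (n := n)) := by unfold FF; fun_prop
  exact (isClosed_le continuous_const hc).inter (isClosed_le continuous_snd.norm continuous_const)

lemma KK_compact (n : ℕ) (N : ℝ) : IsCompact (KK n N) := by
  apply Metric.isCompact_of_isClosed_isBounded (KK_closed n N)
  apply (Metric.isBounded_closedBall (x := (0 : Spacetime n)) (r := Real.exp (2 * N))).subset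
  intro q hq
  have h1 : |q.1| < ‖q.2‖ := KK_sub n N hq
  rw [mem_closedBall_zero_iff, Prod.norm_def]
  exact max_le (h1.le.trans hq.2) hq.2

lemma eta_zero {n : ℕ} (h : ℝ → ℝ) (hz : ∀ x, 2 ≤ |x| → h x = 0) (N : ℝ) (hN : 0 < N)
    (q : Spacetime n) (hq : q ∈ Dom n) (hK : q ∉ KK n N) : eta h N q = 0 := by
  by_contra hne
  apply hK
  have hF : 0 < FF q := (FF_pos_iff q).2 hq
  have hr : 0 < ‖q.2‖ := (abs_nonneg q.1).trans_lt hq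
  unfold eta at hne
  have h1 := left_ne_zero_of_mul hne
  have h2 := right_ne_zero_of_mul hne
  have h1' : |Real.log (FF q) / N| < 2 := by
    by_contra hcon
    exact h1 (hz _ (not_lt.1 hcon))
  have h2' : |(Real.log (‖q.2‖ ^ 2) - Real.log (FF q)) / N| < 2 := by
    by_contra hcon
    exact h2 (hz _ (not_lt.1 hcon))
  obtain ⟨a1, a2⟩ := abs_lt.1 h1'
  obtain ⟨b1, b2⟩ := abs_lt.1 h2'
  rw [lt_div_iff₀ hN] at a1
  rw [div_lt_iff₀ hN] at a2 b2
  refine ⟨?_, ?_⟩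
  · rw [← Real.le_log_iff_exp_le hF]
    linarith
  · rw [← Real.log_le_iff_le_exp hr]
    have : Real.log (‖q.2‖ ^ 2) = 2 * Real.log ‖q.2‖ := by simp
    linarith

/-- The divergence estimate. -/
lemma div_bound {n : ℕ} (hn : 2 ≤ n) (δ p : ℝ) (hδ : 0 < δ)
    (hp : 1 + 4 / ((n : ℝ) - 1) ≤ p) (V φ : Spacetime n → ℝ)
    (hV1 : ContDiffOn ℝ 1 V (Dom n))
    (hVbd : ∃ C : ℝ, ∀ q ∈ Dom n, |V q| ≤ C)
    (hVpos : ∀ q ∈ Dom n, 0 < V q)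
    (hVmono : ∀ q ∈ Dom n, q.1 * dt V q + ‖q.2‖ * dr V q ≤
      (((n : ℝ) - 1) / 2) * (p - 1 - 4 / ((n : ℝ) - 1)) * V q)
    (hφ : ContDiffOn ℝ 2 φ (Dom n))
    (heq : ∀ q ∈ Dom n, box φ q - V q * |φ q| ^ (p - 1) * φ q = 0)
    (hdec : Dec δ φ) (a b : ℝ) (ha : 0 < a) (hb : b = a + ((n:ℝ) - 1) / 2)
    (h : ℝ → ℝ) (hh : ContDiff ℝ 1 h) (h0 : ∀ x, 0 ≤ h x) (h1 : ∀ x, h x ≤ 1)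
    (hpos : ∀ x, x ≤ 0 → 0 ≤ deriv h x) (hneg : ∀ x, 0 ≤ x → deriv h x ≤ 0)
    (C : ℝ) (hC : ∀ x, |deriv h x| ≤ C) :
    ∃ K, 0 ≤ K ∧ ∀ N : ℝ, 0 < N → ∀ q ∈ Dom n,
      eta h N q * (a * (p - 1) * (FF q ^ a * GG p V φ q)) - K / N * MM a ((n:ℝ) - 1 + δ) q ≤
      ∑ μ, fderiv ℝ (YY a b p (eta h N) V φ μ) q (ev μ) := by
  have hn' : (2:ℝ) ≤ n := by exact_mod_cast hn
  have hp1 : 1 < p := by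
    have : 0 < 4 / ((n:ℝ) - 1) := by apply div_pos <;> linarith
    linarith
  have hC0 : 0 ≤ C := (abs_nonneg _).trans (hC 0)
  obtain ⟨K, hK, hKb⟩ := flux_bound hn δ a b p hδ ha (by rw [hb]; linarith) hp1 V φ hVbd hVpos hdec
  refine ⟨K * (C + C), by positivity, fun N hN q hq => ?_⟩
  have hmem : Dom n ∈ nhds q := (Dom_open n).mem_nhds hq
  have hF : 0 < FF q := (FF_pos_iff q).2 hq
  have hr : 0 < ‖q.2‖ := (abs_nonneg q.1).trans_lt hq
  obtain ⟨x1, hx1⟩ : ∃ x1, x1 = deriv h (Real.log (FF q) / N) / N *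
      h ((Real.log (‖q.2‖ ^ 2) - Real.log (FF q)) / N) := ⟨_, rfl⟩
  obtain ⟨x2, hx2⟩ : ∃ x2, x2 = h (Real.log (FF q) / N) *
      (deriv h ((Real.log (‖q.2‖ ^ 2) - Real.log (FF q)) / N) / N) := ⟨_, rfl⟩
  obtain ⟨η', hη', hη'q, hη'gr⟩ := eta_hasFDerivAt h hh N q hq x1 x2 hx1 hx2
  have hηnn : 0 ≤ eta h N q := mul_nonneg (h0 _) (h0 _)
  have hx1b : |x1| ≤ C / N := by
    rw [hx1, abs_mul, abs_div, abs_of_pos hN, abs_of_nonneg (h0 _)]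
    calc _ ≤ C / N * 1 := mul_le_mul (by gcongr; exact hC _) (h1 _) (h0 _) (by positivity)
      _ = _ := mul_one _
  have hx2b : |x2| ≤ C / N := by
    rw [hx2, abs_mul, abs_div, abs_of_pos hN, abs_of_nonneg (h0 _)]
    calc _ ≤ 1 * (C / N) := mul_le_mul (h1 _) (by gcongr; exact hC _) (by positivity) (by positivity)
      _ = _ := one_mul _
  have hs1 : FF q ≤ 1 → 0 ≤ x1 := by
    intro hF1
    rw [hx1]
    have := hpos (Real.log (FF q) / N)
      (div_nonpos_of_nonpos_of_nonneg (Real.log_nonpos hF.le hF1) hN.le)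
    have := h0 ((Real.log (‖q.2‖ ^ 2) - Real.log (FF q)) / N)
    positivity
  have hs2 : 1 ≤ FF q → x1 ≤ 0 := by
    intro hF1
    rw [hx1]
    have := hneg (Real.log (FF q) / N) (div_nonneg (Real.log_nonneg hF1) hN.le)
    exact mul_nonpos_of_nonpos_of_nonneg (div_nonpos_of_nonpos_of_nonneg this hN.le) (h0 _)
  have hflux := hKb q hq x1 x2 hs1 hs2
  have hV : DifferentiableAt ℝ V q := (hV1.contDiffAt hmem).differentiableAt one_ne_zero
  rw [main_identity a p hp1 (eta h N) V φ q hq η' hη' hV (hφ.contDiffAt hmem) (heq q hq) b hb,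
    hη'q, hη'gr]
  have hMM : 0 ≤ MM a ((n:ℝ) - 1 + δ) q := by
    rw [MM_eq]
    positivity
  have hfl : K * (|x1| + |x2|) * MM a ((n:ℝ) - 1 + δ) q ≤
      K * (C + C) / N * MM a ((n:ℝ) - 1 + δ) q := by
    apply mul_le_mul_of_nonneg_right _ hMM
    rw [mul_div_assoc, add_div]
    apply mul_le_mul_of_nonneg_left _ hK
    linarith
  have hbulk : eta h N q * (a * (p - 1) * (FF q ^ a * GG p V φ q)) ≤
      eta h N q * (2 * a * FF q ^ (a - 1) * TT b φ q ^ 2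
        + FF q ^ a * (|φ q| ^ (p + 1) / (p + 1)) *
          (- fderiv ℝ V q q + (a * (p - 1) + ((n:ℝ) - 1) / 2 * (p - 1) - 2) * V q)) := by
    apply mul_le_mul_of_nonneg_left _ hηnn
    have e1 : 0 ≤ 2 * a * FF q ^ (a - 1) * TT b φ q ^ 2 := by positivity
    have e2 : a * (p - 1) * V q ≤
        - fderiv ℝ V q q + (a * (p - 1) + ((n:ℝ) - 1) / 2 * (p - 1) - 2) * V q := by
      have := hVmono q hq
      rw [← S_eq V q hr] at this
      have hne : (n:ℝ) - 1 ≠ 0 := by linarith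
      have e3 : (((n : ℝ) - 1) / 2) * (p - 1 - 4 / ((n : ℝ) - 1)) =
        ((n:ℝ) - 1) / 2 * (p - 1) - 2 := by field_simp; ring
      rw [e3] at this
      linarith
    have e4 : 0 ≤ FF q ^ a * (|φ q| ^ (p + 1) / (p + 1)) := by
      have : 0 < p + 1 := by linarith
      positivity
    have e5 := mul_le_mul_of_nonneg_left e2 e4
    have e6 : a * (p - 1) * (FF q ^ a * GG p V φ q) =
      FF q ^ a * (|φ q| ^ (p + 1) / (p + 1)) * (a * (p - 1) * V q) := by
      unfold GG
      ring
    rw [e6]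
    linarith
  linarith

lemma uc_main (n : ℕ) (hn : 2 ≤ n) (δ p : ℝ) (hδ : 0 < δ)
    (hp : 1 + 4 / ((n : ℝ) - 1) ≤ p)
    (V φ : Spacetime n → ℝ)
    (hV1 : ContDiffOn ℝ 1 V (Dom n))
    (hVbd : ∃ C : ℝ, ∀ q ∈ Dom n, |V q| ≤ C)
    (hVpos : ∀ q ∈ Dom n, 0 < V q)
    (hVmono : ∀ q ∈ Dom n, q.1 * dt V q + ‖q.2‖ * dr V q ≤
      (((n : ℝ) - 1) / 2) * (p - 1 - 4 / ((n : ℝ) - 1)) * V q)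
    (hφ : ContDiffOn ℝ 2 φ (Dom n))
    (heq : ∀ q ∈ Dom n, box φ q - V q * |φ q| ^ (p - 1) * φ q = 0)
    (hdec : Dec δ φ) :
    ∀ q ∈ Dom n, φ q = 0 := by
  intro q0 hq0
  by_contra hne
  have hn' : (2:ℝ) ≤ n := by exact_mod_cast hn
  have hp1 : 1 < p := by
    have : 0 < 4 / ((n:ℝ) - 1) := by apply div_pos <;> linarith
    linarith
  obtain ⟨h, hh, h0, h1, hz, hone, hpos, hneg, C, hC0, hC⟩ := exists_cutoff
  obtain ⟨a, ha, haδ, ha1⟩ : ∃ a : ℝ, 0 < a ∧ a < δ ∧ a < 1 := by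
    obtain ⟨a, h1, h2⟩ := exists_between (lt_min hδ one_pos)
    exact ⟨a, h1, h2.trans_le (min_le_left _ _), h2.trans_le (min_le_right _ _)⟩
  obtain ⟨b, hb⟩ : ∃ b, b = a + ((n:ℝ) - 1) / 2 := ⟨_, rfl⟩
  obtain ⟨K, hK, hKb⟩ := div_bound hn δ p hδ hp V φ hV1 hVbd hVpos hVmono hφ heq hdec a b ha hb
    h hh h0 h1 hpos hneg C hC
  have hMint := MM_int n hn a ((n:ℝ) - 1 + δ) ha ha1 (by linarith)
  -- the neighbourhood
  have hmem : Dom n ∈ nhds q0 := (Dom_open n).mem_nhds hq0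
  have hF : 0 < FF q0 := (FF_pos_iff q0).2 hq0
  have hr : 0 < ‖q0.2‖ := (abs_nonneg q0.1).trans_lt hq0
  have hR : 0 < ‖q0.2‖ ^ 2 := by positivity
  set g : Spacetime n → ℝ := fun q => a * (p - 1) * (FF q ^ a * GG p V φ q) with hg
  have hg0 : 0 < g q0 := by
    simp only [hg, GG]
    have := hVpos q0 hq0
    have := abs_pos.2 hne
    have : 0 < p - 1 := by linarith
    have : 0 < p + 1 := by linarith
    positivity
  have cFF : ContinuousAt (FF (n := n)) q0 := by
    have : Continuous (FF (n := n)) := by unfold FF; fun_prop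
    exact this.continuousAt
  have cg : ContinuousAt g q0 := by
    have cV : ContinuousAt V q0 := (hV1.contDiffAt hmem).continuousAt
    have cφ : ContinuousAt φ q0 := (hφ.contDiffAt hmem).continuousAt
    have cP : ContinuousAt (fun q => |φ q| ^ (p + 1)) q0 :=
      cφ.abs.rpow_const (Or.inr (by linarith))
    exact continuousAt_const.mul ((cFF.rpow_const (Or.inl hF.ne')).mul ((cV.mul cP).div_const _))
  have cl : ContinuousAt (fun q : Spacetime n => |Real.log (FF q)|) q0 := (cFF.log hF.ne').abs
  have cs : ContinuousAt (fun q : Spacetime n =>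
      |Real.log (‖q.2‖ ^ 2) - Real.log (FF q)|) q0 := by
    have cR : ContinuousAt (fun q : Spacetime n => ‖q.2‖ ^ 2) q0 := by fun_prop
    exact ((cR.log hR.ne').sub (cFF.log hF.ne')).abs
  have hev := (((cg.eventually_const_lt (half_lt_self hg0)).and
    (cl.eventually_lt_const (lt_add_one _))).and (cs.eventually_lt_const (lt_add_one _))).and hmem
  obtain ⟨ε, hε, hball⟩ := Metric.eventually_nhds_iff_ball.1 hev
  set B := Metric.ball q0 ε with hB
  have hBfin : volume B ≠ ⊤ := measure_ball_lt_top.ne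
  have hBpos : 0 < (volume B).toReal :=
    ENNReal.toReal_pos (Metric.measure_ball_pos volume q0 hε).ne' hBfin
  set I := ∫ q in Dom n, MM a ((n:ℝ) - 1 + δ) q with hI
  set N0 := |Real.log (FF q0)| + |Real.log (‖q0.2‖ ^ 2) - Real.log (FF q0)| + 1 with hN0
  have hN0pos : 0 < N0 := by positivity
  have main : ∀ N : ℝ, N0 ≤ N → g q0 / 2 * (volume B).toReal ≤ K / N * I := by
    intro N hN
    have hNpos : 0 < N := hN0pos.trans_le hN
    set Z : Option (Fin n) → Spacetime n → ℝ :=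
      fun μ => (Dom n).indicator (YY a b p (eta h N) V φ μ) with hZ
    have hZK : ∀ μ, ∀ q, q ∉ KK n N → Z μ q = 0 := by
      intro μ q hq
      by_cases hqD : q ∈ Dom n
      · simp only [hZ, Set.indicator_of_mem hqD]
        simp [YY, AA, BB, eta_zero h hz N hNpos q hqD hq]
      · simp only [hZ, Set.indicator_of_notMem hqD]
    have hZsupp : ∀ μ, tsupport (Z μ) ⊆ KK n N := by
      intro μ
      apply closure_minimal _ (KK_closed n N)
      intro q hq
      by_contra hqK
      exact hq (hZK μ q hqK)
    have hZeq : ∀ μ, ∀ q ∈ Dom n, Z μ =ᶠ[nhds q] YY a b p (eta h N) V φ μ := by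
      intro μ q hq
      filter_upwards [(Dom_open n).mem_nhds hq] with y hy
      exact Set.indicator_of_mem hy _
    have hZc : ∀ μ, ContDiff ℝ 1 (Z μ) := by
      intro μ
      rw [contDiff_iff_contDiffAt]
      intro q
      by_cases hq : q ∈ tsupport (Z μ)
      swap
      · exact contDiffAt_const.congr_of_eventuallyEq (notMem_tsupport_iff_eventuallyEq.1 hq)
      have hqD := KK_sub n N (hZsupp μ hq)
      have hm := (Dom_open n).mem_nhds hqD
      exact (contDiffAt_YY h hh N a b p hp1 V φ q hqD (hV1.contDiffAt hm)
        (hφ.contDiffAt hm) μ).congr_of_eventuallyEq (hZeq μ q hqD)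
    have hZcs : ∀ μ, HasCompactSupport (Z μ) := fun μ =>
      HasCompactSupport.intro (KK_compact n N) (hZK μ)
    have hZint : ∀ μ, Integrable (fun q => fderiv ℝ (Z μ) q (ev μ)) ∧
        ∫ q, fderiv ℝ (Z μ) q (ev μ) = 0 := fun μ =>
      int_fderiv_zero (Z μ) (ev μ) (hZc μ) (hZcs μ)
    have hdint : Integrable (fun q => ∑ μ, fderiv ℝ (Z μ) q (ev μ)) :=
      integrable_finsetSum _ (fun μ _ => (hZint μ).1)
    have hdzero : ∫ q, ∑ μ, fderiv ℝ (Z μ) q (ev μ) = 0 := by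
      rw [integral_finsetSum _ (fun μ _ => (hZint μ).1)]
      exact Finset.sum_eq_zero fun μ _ => (hZint μ).2
    have hBint : Integrable (B.indicator (fun _ : Spacetime n => g q0 / 2)) := by
      rw [integrable_indicator_iff measurableSet_ball]
      exact integrableOn_const hBfin
    have hMint' : Integrable ((Dom n).indicator (MM (n := n) a ((n:ℝ) - 1 + δ))) := by
      rw [integrable_indicator_iff (Dom_open n).measurableSet]
      exact hMint
    have hle : ∀ q, B.indicator (fun _ : Spacetime n => g q0 / 2) q
        - K / N * (Dom n).indicator (MM (n := n) a ((n:ℝ) - 1 + δ)) q ≤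
        ∑ μ, fderiv ℝ (Z μ) q (ev μ) := by
      intro q
      by_cases hqD : q ∈ Dom n
      · have e1 : ∑ μ, fderiv ℝ (Z μ) q (ev μ)
            = ∑ μ, fderiv ℝ (YY a b p (eta h N) V φ μ) q (ev μ) := by
          apply Finset.sum_congr rfl
          intro μ _
          rw [(hZeq μ q hqD).fderiv_eq]
        rw [e1, Set.indicator_of_mem hqD]
        refine le_trans ?_ (hKb N hNpos q hqD)
        apply sub_le_sub_right
        by_cases hqB : q ∈ B
        · obtain ⟨⟨⟨k1, k2⟩, k3⟩, -⟩ := hball q hqB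
          have e2 : eta h N q = 1 := by
            unfold eta
            rw [hone, hone, one_mul]
            · rw [abs_div, abs_of_pos hNpos, div_le_one hNpos]
              have := abs_nonneg (Real.log (FF q0))
              linarith
            · rw [abs_div, abs_of_pos hNpos, div_le_one hNpos]
              have := abs_nonneg (Real.log (‖q0.2‖ ^ 2) - Real.log (FF q0))
              linarith
          rw [Set.indicator_of_mem hqB, e2, one_mul]
          exact k1.le
        · rw [Set.indicator_of_notMem hqB]
          apply mul_nonneg (mul_nonneg (h0 _) (h0 _))
          have := hVpos q hqD
          have := (FF_pos_iff q).2 hqD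
          have : 0 < p - 1 := by linarith
          have : 0 < p + 1 := by linarith
          unfold GG
          positivity
      · have hqB : q ∉ B := fun hqB => hqD (hball q hqB).2
        rw [Set.indicator_of_notMem hqD, Set.indicator_of_notMem hqB]
        have e1 : ∀ μ, fderiv ℝ (Z μ) q (ev μ) = 0 := by
          intro μ
          rw [fderiv_of_notMem_tsupport ℝ (fun hq => hqD (KK_sub n N (hZsupp μ hq)))]
          simp
        simp [e1]
    have hmono := integral_mono (hBint.sub (hMint'.const_mul (K / N))) hdint hle
    simp only [Pi.sub_apply] at hmono
    rw [hdzero, integral_sub hBint (hMint'.const_mul (K / N)), integral_const_mul,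
      integral_indicator measurableSet_ball, integral_indicator (Dom_open n).measurableSet,
      setIntegral_const, smul_eq_mul, Measure.real] at hmono
    linarith
  have hX : 0 < g q0 / 2 * (volume B).toReal := by positivity
  obtain ⟨N, hN1, hN2⟩ : ∃ N : ℝ, N0 ≤ N ∧ K * I / (g q0 / 2 * (volume B).toReal) < N :=
    ⟨max N0 (K * I / (g q0 / 2 * (volume B).toReal) + 1), le_max_left _ _,
      (lt_add_one _).trans_le (le_max_right _ _)⟩
  have hNpos : 0 < N := hN0pos.trans_le hN1
  have := main N hN1
  rw [div_lt_iff₀ hX] at hN2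
  rw [div_mul_eq_mul_div K N I, le_div_iff₀ hNpos] at this
  linarith


end UC

/-- **Theorem 1.10** (unique continuation for conformal/superconformal defocusing equations
`□φ − V|φ|^{p−1}φ = 0`, `p ≥ 1 + 4/(n−1)`): if the positive potential `V ∈ C¹(D) ∩ L^∞(D)`
satisfies `t·∂_t V + r·∂_r V ≤ ((n−1)/2)(p − 1 − 4/(n−1))·V`, and the `C²` solution `φ`
satisfies the decay condition `Dec(δ)`, then `φ ≡ 0` on `D`. -/
theorem uc_defocusing (n : ℕ) (hn : 2 ≤ n) (δ p : ℝ) (hδ : 0 < δ)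
    (hp : 1 + 4 / ((n : ℝ) - 1) ≤ p)
    (V φ : Spacetime n → ℝ)
    (hV1 : ContDiffOn ℝ 1 V (Dom n))
    (hVbd : ∃ C : ℝ, ∀ q ∈ Dom n, |V q| ≤ C)
    (hVpos : ∀ q ∈ Dom n, 0 < V q)
    (hVmono : ∀ q ∈ Dom n, q.1 * dt V q + ‖q.2‖ * dr V q ≤
      (((n : ℝ) - 1) / 2) * (p - 1 - 4 / ((n : ℝ) - 1)) * V q)
    (hφ : ContDiffOn ℝ 2 φ (Dom n))
    (heq : ∀ q ∈ Dom n, box φ q - V q * |φ q| ^ (p - 1) * φ q = 0)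
    (hdec : Dec δ φ) :
    ∀ q ∈ Dom n, φ q = 0 := by
  exact UC.uc_main n hn δ p hδ hp V φ hV1 hVbd hVpos hVmono hφ heq hdec
end
end
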